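/- Let X be a proper irreducible CAT(0) space with finite-dimensional Tits boundary and let Γ ≤ Isom(X) be a subgroup acting minimally on X and without global fixed point in ∂X. Then the Γ-action is reduced: there is no unbounded closed convex subset Y ⊊ X such that gY is at finite Hausdorff distance from Y for every g ∈ Γ. -/

import Mathlib

open Metric Set Filter

universe u v

variable {X : Type u}

/-- An affinely parametrised geodesic segment from `x` to `y`, defined on `[0,1]`. -/
def IsGeodesicSeg [MetricSpace X] (x y : X) (γ : ℝ → X) : Prop :=
  γ 0 = x ∧ γ 1 = y ∧
    ∀ s ∈ Set.Icc (0:ℝ) 1, ∀ t ∈ Set.Icc (0:ℝ) 1, dist (γ s) (γ t) = |s - t| * dist x y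

/-- A CAT(0) space: a geodesic metric space in which every geodesic triangle is at least as
thin as its Euclidean comparison triangle, expressed via the standard comparison
(convexity) inequality along geodesics. -/
class CAT0Space (X : Type u) [MetricSpace X] : Prop where
  exists_geodesic : ∀ x y : X, ∃ γ : ℝ → X, IsGeodesicSeg x y γ
  comparison : ∀ (p x y : X) (γ : ℝ → X), IsGeodesicSeg x y γ → ∀ t ∈ Set.Icc (0:ℝ) 1,
    dist p (γ t) ^ 2 ≤ (1 - t) * dist p x ^ 2 + t * dist p y ^ 2 - t * (1 - t) * dist x y ^ 2

/-- A subset is (geodesically) convex if it contains every geodesic segment between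
any two of its points. -/
def GeoConvex [MetricSpace X] (C : Set X) : Prop :=
  ∀ x ∈ C, ∀ y ∈ C, ∀ γ : ℝ → X, IsGeodesicSeg x y γ → ∀ t ∈ Set.Icc (0:ℝ) 1, γ t ∈ C

/-- Every geodesic segment of positive length extends to a locally isometric embedding
of the whole real line. -/
def GeodesicallyComplete (X : Type u) [MetricSpace X] : Prop :=
  ∀ x y : X, x ≠ y → ∀ γ : ℝ → X, IsGeodesicSeg x y γ →
    ∃ ℓ : ℝ → X,
      (∀ t : ℝ, ∃ ε > (0:ℝ), ∀ s₁ ∈ Set.Ioo (t - ε) (t + ε), ∀ s₂ ∈ Set.Ioo (t - ε) (t + ε),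
        dist (ℓ s₁) (ℓ s₂) = |s₁ - s₂|) ∧
      ∀ t ∈ Set.Icc (0:ℝ) 1, ℓ (t * dist x y) = γ t

/-- A (unit speed) geodesic ray, parametrised by `[0,∞)`. -/
structure GeodesicRay (X : Type u) [MetricSpace X] where
  toFun : ℝ → X
  isom : ∀ s, 0 ≤ s → ∀ t, 0 ≤ t → dist (toFun s) (toFun t) = |s - t|

/-- Two rays are asymptotic if they remain at bounded distance. -/
def GeodesicRay.Asymp [MetricSpace X] (ρ σ : GeodesicRay X) : Prop :=
  ∃ C : ℝ, ∀ t, 0 ≤ t → dist (ρ.toFun t) (σ.toFun t) ≤ C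

theorem GeodesicRay.asymp_equivalence (X : Type u) [MetricSpace X] :
    Equivalence (GeodesicRay.Asymp (X := X)) where
  refl ρ := ⟨0, fun t _ => by simp⟩
  symm := fun {ρ σ} ⟨C, hC⟩ => ⟨C, fun t ht => by rw [dist_comm]; exact hC t ht⟩
  trans := fun {ρ σ τ} ⟨C₁, h₁⟩ ⟨C₂, h₂⟩ =>
    ⟨C₁ + C₂, fun t ht => (dist_triangle (ρ.toFun t) (σ.toFun t) (τ.toFun t)).trans
      (add_le_add (h₁ t ht) (h₂ t ht))⟩

instance GeodesicRay.setoid (X : Type u) [MetricSpace X] : Setoid (GeodesicRay X) :=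
  ⟨GeodesicRay.Asymp, GeodesicRay.asymp_equivalence X⟩

/-- The boundary at infinity: asymptote classes of geodesic rays. -/
def Boundary (X : Type u) [MetricSpace X] : Type u := Quotient (GeodesicRay.setoid X)

/-- The boundary point determined by a ray. -/
def GeodesicRay.cls [MetricSpace X] (ρ : GeodesicRay X) : Boundary X := Quotient.mk _ ρ

/-- The boundary at infinity of a subset `Y ⊆ X`: classes of rays staying within
bounded distance of `Y`. -/
def boundarySet [MetricSpace X] (Y : Set X) : Set (Boundary X) :=
  {ξ | ∃ ρ : GeodesicRay X, ρ.cls = ξ ∧ ∃ C : ℝ, ∀ t, 0 ≤ t → ∃ y ∈ Y, dist (ρ.toFun t) y ≤ C}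

/-- Composition of a ray with an isometric map. -/
def GeodesicRay.comp [MetricSpace X] (f : X → X) (hf : Isometry f) (ρ : GeodesicRay X) :
    GeodesicRay X :=
  ⟨fun t => f (ρ.toFun t), fun s hs t ht => by simpa [hf.dist_eq] using ρ.isom s hs t ht⟩

/-- The induced map of an isometric map on the boundary at infinity. -/
def Boundary.map [MetricSpace X] (f : X → X) (hf : Isometry f) : Boundary X → Boundary X :=
  Quotient.map (GeodesicRay.comp f hf)
    (fun ρ σ h => by
      obtain ⟨C, hC⟩ := h
      exact ⟨C, fun t ht => by simpa [GeodesicRay.comp, hf.dist_eq] using hC t ht⟩)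

/-- The Euclidean comparison angle at `p` of the points `x, y`. -/
noncomputable def cmpAngle [MetricSpace X] (p x y : X) : ℝ :=
  Real.arccos ((dist p x ^ 2 + dist p y ^ 2 - dist x y ^ 2) / (2 * dist p x * dist p y))

/-- The Alexandrov angle between two geodesic rays issuing from the same point
(in a CAT(0) space, the comparison angles are monotone, so the limit defining the
Alexandrov angle is the infimum of comparison angles). -/
noncomputable def alexAngleRays [MetricSpace X] (ρ σ : ℝ → X) : ℝ :=
  sInf {a | ∃ s, 0 < s ∧ ∃ t, 0 < t ∧ a = cmpAngle (ρ 0) (ρ s) (σ t)}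

/-- The Alexandrov angle between two geodesic segments (parametrised on `[0,1]`)
issuing from the same point. -/
noncomputable def alexAngleSegs [MetricSpace X] (γ δ : ℝ → X) : ℝ :=
  sInf {a | ∃ s ∈ Set.Ioc (0:ℝ) 1, ∃ t ∈ Set.Ioc (0:ℝ) 1, a = cmpAngle (γ 0) (γ s) (δ t)}

/-- The Tits angle between two boundary points: the supremum over basepoints of the
Alexandrov angle between the rays issuing from that basepoint representing them. -/
noncomputable def titsAngle [MetricSpace X] (ξ η : Boundary X) : ℝ :=
  sSup {a | ∃ ρ σ : GeodesicRay X, ρ.toFun 0 = σ.toFun 0 ∧ ρ.cls = ξ ∧ σ.cls = η ∧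
    a = alexAngleRays ρ.toFun σ.toFun}

/-- The circumradius of `Z` within `Y`, with respect to the distance function `d`. -/
noncomputable def circumradiusIn {B : Type v} (d : B → B → ℝ) (Y Z : Set B) : ℝ :=
  sInf ((fun y => sSup ((fun z => d y z) '' Z)) '' Y)

/-- The topology of the Tits boundary, generated by the balls of the Tits angle metric. -/
instance boundaryTopology (X : Type u) [MetricSpace X] : TopologicalSpace (Boundary X) :=
  TopologicalSpace.generateFrom
    {U | ∃ (ξ : Boundary X) (r : ℝ), U = {η | titsAngle ξ η < r}}

/-- Lebesgue covering dimension of a subset `K` is at most `n`: every open cover of `K`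
admits an open refinement covering `K` of multiplicity at most `n+1` on `K`. -/
def CovDimSubsetLE {B : Type v} [TopologicalSpace B] (K : Set B) (n : ℕ) : Prop :=
  ∀ 𝒰 : Set (Set B), (∀ U ∈ 𝒰, IsOpen U) → K ⊆ ⋃₀ 𝒰 →
    ∃ 𝒱 : Set (Set B), (∀ V ∈ 𝒱, IsOpen V) ∧ K ⊆ ⋃₀ 𝒱 ∧
      (∀ V ∈ 𝒱, ∃ U ∈ 𝒰, V ⊆ U) ∧
      ∀ x ∈ K, {V | V ∈ 𝒱 ∧ x ∈ V}.Finite ∧ {V | V ∈ 𝒱 ∧ x ∈ V}.ncard ≤ n + 1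

/-- The Tits boundary is finite-dimensional: the topological dimension of compact
subsets of the Tits boundary is bounded. -/
def FiniteDimTitsBoundary (X : Type u) [MetricSpace X] : Prop :=
  ∃ n : ℕ, ∀ K : Set (Boundary X), IsCompact K → CovDimSubsetLE K n

/-- The topology of uniform convergence on compacta (compact-open topology) on the
isometry group of `X`. -/
instance isomEquivTopology (X : Type u) [MetricSpace X] : TopologicalSpace (X ≃ᵢ X) :=
  TopologicalSpace.induced (fun g : X ≃ᵢ X => (⟨⇑g, g.continuous⟩ : C(X, X)))
    ContinuousMap.compactOpen

/-- A subgroup of the isometry group acts minimally: there is no nonempty proper closed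
convex invariant subset. -/
def MinimalSubgroupAction [MetricSpace X] (G : Subgroup (X ≃ᵢ X)) : Prop :=
  ∀ C : Set X, C.Nonempty → IsClosed C → GeoConvex C →
    (∀ g ∈ G, ∀ x ∈ C, g x ∈ C) → C = Set.univ

section SMulNotions
variable {G : Type v} [Group G] [MulAction G X] [MetricSpace X]

/-- The translation length of `g`. -/
noncomputable def transLength (g : G) : ℝ := sInf (Set.range fun x : X => dist (g • x) x)

/-- `g` acts as an elliptic isometry: it fixes a point. -/
def IsEllipticSMul (g : G) : Prop := ∃ x : X, g • x = x

/-- `g` acts as a hyperbolic isometry: its translation length is positive and attained. -/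
def IsHyperbolicSMul (g : G) : Prop :=
  ∃ x : X, dist (g • x) x = transLength (X := X) g ∧ 0 < dist (g • x) x

end SMulNotions

/-- The Busemann function associated with a geodesic ray, based at `ρ 0`
(the limit exists, hence agrees with the `limsup`). -/
noncomputable def busemann [MetricSpace X] (ρ : GeodesicRay X) (y : X) : ℝ :=
  Filter.limsup (fun t : ℝ => dist (ρ.toFun t) y - dist (ρ.toFun t) (ρ.toFun 0)) Filter.atTop

/-- Convergence of a sequence to a boundary point in the cône topology (in a CAT(0)
space): the sequence escapes to infinity and the geodesics from the basepoint `p` to the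
points of the sequence converge pointwise to the ray from `p` representing `η`. -/
def SeqTendstoBoundary [MetricSpace X] (p : X) (u : ℕ → X) (η : Boundary X) : Prop :=
  Filter.Tendsto (fun n => dist p (u n)) Filter.atTop Filter.atTop ∧
  ∃ σ : GeodesicRay X, σ.toFun 0 = p ∧ σ.cls = η ∧
    ∀ γ : ℕ → ℝ → X, (∀ n, IsGeodesicSeg p (u n) (γ n)) →
      ∀ t, 0 ≤ t →
        Filter.Tendsto (fun n => γ n (t / dist p (u n))) Filter.atTop (nhds (σ.toFun t))

/-- The closed convex hull of a subset. -/
def closedGeoConvexHull [MetricSpace X] (S : Set X) : Set X :=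
  ⋂₀ {C : Set X | IsClosed C ∧ GeoConvex C ∧ S ⊆ C}

/-- A real function is convex if its restriction to every geodesic is convex. -/
def ConvexFun [MetricSpace X] (f : X → ℝ) : Prop :=
  ∀ (x y : X) (γ : ℝ → X), IsGeodesicSeg x y γ →
    ∀ s ∈ Set.Icc (0:ℝ) 1, ∀ t ∈ Set.Icc (0:ℝ) 1, ∀ a b : ℝ, 0 ≤ a → 0 ≤ b → a + b = 1 →
      f (γ (a * s + b * t)) ≤ a * f (γ s) + b * f (γ t)

/-- `X` is boundary-minimal: no proper closed convex subset has full boundary. -/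
def BoundaryMinimal (X : Type u) [MetricSpace X] : Prop :=
  ∀ Y : Set X, IsClosed Y → GeoConvex Y → boundarySet Y = boundarySet (Set.univ : Set X) →
    Y = Set.univ

/-- A geodesic segment with respect to an abstract distance function `d`. -/
def IsGeodesicSegD {B : Type v} (d : B → B → ℝ) (x y : B) (γ : ℝ → B) : Prop :=
  γ 0 = x ∧ γ 1 = y ∧
    ∀ s ∈ Set.Icc (0:ℝ) 1, ∀ t ∈ Set.Icc (0:ℝ) 1, d (γ s) (γ t) = |s - t| * d x y

/-- Convexity with respect to an abstract distance function `d`. -/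
def DConvex {B : Type v} (d : B → B → ℝ) (A : Set B) : Prop :=
  ∀ x ∈ A, ∀ y ∈ A, ∀ γ : ℝ → B, IsGeodesicSegD d x y γ → ∀ t ∈ Set.Icc (0:ℝ) 1, γ t ∈ A

/-- `X` is irreducible: it admits no isometric splitting as an (ℓ²-)product with both
factors containing more than one point. -/
def IrreducibleCAT0 (X : Type u) [MetricSpace X] : Prop :=
  ¬ ∃ (A : Type u) (B : Type u) (_ : MetricSpace A) (_ : MetricSpace B)
      (_ : X ≃ᵢ WithLp 2 (A × B)), Nontrivial A ∧ Nontrivial B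

/-- The forward ray of a geodesic line. -/
def GeodesicRay.ofLineFwd [MetricSpace X] (ℓ : ℝ → X)
    (h : ∀ s t : ℝ, dist (ℓ s) (ℓ t) = |s - t|) : GeodesicRay X :=
  ⟨ℓ, fun s _ t _ => h s t⟩

/-- The backward ray of a geodesic line. -/
def GeodesicRay.ofLineBwd [MetricSpace X] (ℓ : ℝ → X)
    (h : ∀ s t : ℝ, dist (ℓ s) (ℓ t) = |s - t|) : GeodesicRay X :=
  ⟨fun t => ℓ (-t), fun s _ t _ => by
    rw [h (-s) (-t), show (-s) - (-t) = -(s - t) by ring, abs_neg]⟩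

/-- Two boundary points are opposite if they are the two endpoints of a geodesic line. -/
def OppositeBd [MetricSpace X] (ξ η : Boundary X) : Prop :=
  ∃ (ℓ : ℝ → X) (h : ∀ s t : ℝ, dist (ℓ s) (ℓ t) = |s - t|),
    (GeodesicRay.ofLineBwd ℓ h).cls = ξ ∧ (GeodesicRay.ofLineFwd ℓ h).cls = η

/-- An isometry is parabolic if its displacement function does not attain its infimum. -/
def IsParabolicIsom [MetricSpace X] (g : X ≃ᵢ X) : Prop :=
  ¬ ∃ x : X, dist (g x) x = sInf (Set.range fun y : X => dist (g y) y)

/-- The fixed-point set of an isometry in the boundary at infinity. -/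
def boundaryFixedSet [MetricSpace X] (g : X ≃ᵢ X) : Set (Boundary X) :=
  {ξ | Boundary.map (⇑g) g.isometry ξ = ξ}



section Segments
variable [MetricSpace X] [CAT0Space X]

/-- The geodesic segment from `x` to `y`, parametrised proportionally to arc length. -/
noncomputable def geo (x y : X) : ℝ → X :=
  Classical.choose (CAT0Space.exists_geodesic x y)

theorem geo_seg (x y : X) : IsGeodesicSeg x y (geo x y) :=
  Classical.choose_spec (CAT0Space.exists_geodesic x y)

theorem geo_zero (x y : X) : geo x y 0 = x := (geo_seg x y).1

theorem geo_one (x y : X) : geo x y 1 = y := (geo_seg x y).2.1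

theorem dist_left_geo (x y : X) {t : ℝ} (ht : t ∈ Icc (0:ℝ) 1) :
    dist x (geo x y t) = t * dist x y := by
  have h := (geo_seg x y).2.2 0 (by simp) t ht
  rw [geo_zero] at h
  rw [h, zero_sub, abs_neg, abs_of_nonneg ht.1]

theorem dist_right_geo (x y : X) {t : ℝ} (ht : t ∈ Icc (0:ℝ) 1) :
    dist y (geo x y t) = (1 - t) * dist x y := by
  have h := (geo_seg x y).2.2 1 (by simp) t ht
  rw [geo_one] at h
  rw [h, abs_of_nonneg (by linarith [ht.2])]

theorem comparison_geo (p x y : X) {t : ℝ} (ht : t ∈ Icc (0:ℝ) 1) :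
    dist p (geo x y t) ^ 2 ≤
      (1 - t) * dist p x ^ 2 + t * dist p y ^ 2 - t * (1 - t) * dist x y ^ 2 :=
  CAT0Space.comparison p x y _ (geo_seg x y) t ht

theorem IsGeodesicSeg.eq_geo {x y : X} {γ : ℝ → X} (h : IsGeodesicSeg x y γ) {t : ℝ}
    (ht : t ∈ Icc (0:ℝ) 1) : γ t = geo x y t := by
  have h1 := CAT0Space.comparison (geo x y t) x y γ h t ht
  rw [dist_comm (geo x y t) x, dist_comm (geo x y t) y, dist_left_geo x y ht,
    dist_right_geo x y ht] at h1
  have h2 : dist (geo x y t) (γ t) ^ 2 ≤ 0 := by nlinarith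
  have h3 : dist (geo x y t) (γ t) = 0 := by
    have := sq_nonneg (dist (geo x y t) (γ t))
    exact pow_eq_zero_iff (two_ne_zero) |>.1 (le_antisymm h2 this)
  exact (dist_eq_zero.1 h3).symm

theorem eq_geo_of_dist {x y z : X} {t : ℝ} (ht : t ∈ Icc (0:ℝ) 1)
    (h1 : dist x z ≤ t * dist x y) (h2 : dist y z ≤ (1 - t) * dist x y) : z = geo x y t := by
  have h := comparison_geo z x y ht
  rw [dist_comm z x, dist_comm z y] at h
  have e1 : dist x z ^ 2 ≤ (t * dist x y) ^ 2 := by gcongr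
  have e2 : dist y z ^ 2 ≤ ((1 - t) * dist x y) ^ 2 := by gcongr
  have h2 : dist z (geo x y t) ^ 2 ≤ 0 := by
    nlinarith [mul_le_mul_of_nonneg_left e1 (by linarith [ht.2] : 0 ≤ 1 - t),
      mul_le_mul_of_nonneg_left e2 ht.1]
  exact dist_eq_zero.1 (pow_eq_zero_iff (two_ne_zero) |>.1 (le_antisymm h2 (sq_nonneg _)))

theorem geo_symm (x y : X) {t : ℝ} (ht : t ∈ Icc (0:ℝ) 1) : geo x y t = geo y x (1 - t) := by
  have ht' : 1 - t ∈ Icc (0:ℝ) 1 := ⟨by linarith [ht.2], by linarith [ht.1]⟩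
  apply eq_geo_of_dist ht'
  · rw [dist_right_geo x y ht, dist_comm]
  · rw [dist_left_geo x y ht, dist_comm y x]; linarith

theorem GeoConvex.geo_mem {C : Set X} (hC : GeoConvex C) {x y : X} (hx : x ∈ C) (hy : y ∈ C)
    {t : ℝ} (ht : t ∈ Icc (0:ℝ) 1) : geo x y t ∈ C :=
  hC x hx y hy _ (geo_seg x y) t ht

theorem geoConvex_of_geo_mem {C : Set X}
    (h : ∀ x ∈ C, ∀ y ∈ C, ∀ t ∈ Icc (0:ℝ) 1, geo x y t ∈ C) : GeoConvex C := by
  intro x hx y hy γ hγ t ht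
  rw [hγ.eq_geo ht]
  exact h x hx y hy t ht

theorem dist_geo_geo_left (x y z : X) {t : ℝ} (ht : t ∈ Icc (0:ℝ) 1) :
    dist (geo x y t) (geo x z t) ≤ t * dist y z := by
  have h1 := comparison_geo (geo x y t) x z ht
  have h2 := comparison_geo z x y ht
  rw [dist_comm (geo x y t) x, dist_left_geo x y ht, dist_comm (geo x y t) z] at h1
  rw [dist_comm z x, dist_comm z y] at h2
  have h3 : dist (geo x y t) (geo x z t) ^ 2 ≤ (t * dist y z) ^ 2 := by
    nlinarith [mul_le_mul_of_nonneg_left h2 ht.1]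
  exact le_of_sq_le_sq h3 (mul_nonneg ht.1 dist_nonneg)

theorem dist_geo_geo (x y x' y' : X) {t : ℝ} (ht : t ∈ Icc (0:ℝ) 1) :
    dist (geo x y t) (geo x' y' t) ≤ (1 - t) * dist x x' + t * dist y y' := by
  have ht' : 1 - t ∈ Icc (0:ℝ) 1 := ⟨by linarith [ht.2], by linarith [ht.1]⟩
  have h1 := dist_geo_geo_left x y y' ht
  have h2 := dist_geo_geo_left y' x x' ht'
  rw [← geo_symm x y' ht, ← geo_symm x' y' ht] at h2
  linarith [dist_triangle (geo x y t) (geo x y' t) (geo x' y' t)]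

theorem quadrilateral (a b c d : X) :
    dist a c ^ 2 + dist b d ^ 2 ≤
      dist a b ^ 2 + dist c d ^ 2 + 2 * dist b c * dist a d := by
  rcases eq_or_ne a d with rfl | had
  · simp [dist_comm]; linarith
  rcases eq_or_ne b c with rfl | hbc
  · simp
  have h1 : 0 < dist a d := dist_pos.2 had
  have h2 : 0 < dist b c := dist_pos.2 hbc
  set A := dist a d
  set B := dist b c
  have hAB : 0 < A + B := by linarith
  have ht : B / (A + B) ∈ Icc (0:ℝ) 1 :=
    ⟨by positivity, by rw [div_le_one hAB]; linarith⟩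
  set t := B / (A + B) with htdef
  have htA : 1 - t = A / (A + B) := by rw [htdef]; field_simp; ring
  have c1 := comparison_geo a b d ht
  have c2 := comparison_geo c b d ht
  set e := geo b d t
  have tr : dist a c ≤ dist a e + dist c e := by
    rw [dist_comm c e]; exact dist_triangle a e c
  have t0 : 0 < t := by positivity
  have t1 : 0 < 1 - t := by rw [htA]; positivity
  have key : t * (1 - t) * dist a c ^ 2 ≤ t * dist a e ^ 2 + (1 - t) * dist c e ^ 2 := by
    have : dist a c ^ 2 ≤ (dist a e + dist c e) ^ 2 := by gcongr
    nlinarith [sq_nonneg (t * dist a e - (1 - t) * dist c e), mul_pos t0 t1,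
      mul_le_mul_of_nonneg_left this (mul_pos t0 t1).le]
  have hcb : dist c b = B := dist_comm c b
  rw [hcb] at c2
  have fin : t * (1 - t) * (dist a c ^ 2 + dist b d ^ 2) ≤
      t * (1 - t) * (dist a b ^ 2 + dist c d ^ 2) + (t ^ 2 * A ^ 2 + (1 - t) ^ 2 * B ^ 2) := by
    nlinarith [mul_le_mul_of_nonneg_left c1 t0.le, mul_le_mul_of_nonneg_left c2 t1.le]
  have e1 : t ^ 2 * A ^ 2 + (1 - t) ^ 2 * B ^ 2 = t * (1 - t) * (2 * B * A) := by
    rw [htA, htdef]; field_simp; ring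
  rw [e1, ← mul_add] at fin
  exact le_of_mul_le_mul_left fin (mul_pos t0 t1)

end Segments

section Projection
variable [MetricSpace X] [CAT0Space X]

theorem infDist_geo_le {C : Set X} (hC : GeoConvex C) (hne : C.Nonempty) (x y : X) {t : ℝ}
    (ht : t ∈ Icc (0:ℝ) 1) :
    infDist (geo x y t) C ≤ (1 - t) * infDist x C + t * infDist y C := by
  refine le_of_forall_pos_le_add fun ε hε => ?_
  obtain ⟨a, ha, hxa⟩ := (infDist_lt_iff hne).1 (lt_add_of_pos_right (infDist x C) hε)
  obtain ⟨b, hb, hyb⟩ := (infDist_lt_iff hne).1 (lt_add_of_pos_right (infDist y C) hε)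
  have h1 := infDist_le_dist_of_mem (x := geo x y t) (hC.geo_mem ha hb ht)
  have h2 := dist_geo_geo x y a b ht
  nlinarith [mul_le_mul_of_nonneg_left hxa.le (by linarith [ht.2] : 0 ≤ 1 - t),
    mul_le_mul_of_nonneg_left hyb.le ht.1]

theorem geoConvex_infDist_le {C : Set X} (hC : GeoConvex C) (hne : C.Nonempty) (r : ℝ) :
    GeoConvex {x | infDist x C ≤ r} := by
  refine geoConvex_of_geo_mem fun x hx y hy t ht => ?_
  have := infDist_geo_le hC hne x y ht
  simp only [mem_ofPred_eq] at *
  nlinarith [mul_le_mul_of_nonneg_left hx (by linarith [ht.2] : 0 ≤ 1 - t),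
    mul_le_mul_of_nonneg_left hy ht.1]

omit [CAT0Space X] in
theorem GeoConvex.inter {C D : Set X} (hC : GeoConvex C) (hD : GeoConvex D) :
    GeoConvex (C ∩ D) := fun x hx y hy γ hγ t ht =>
  ⟨hC x hx.1 y hy.1 γ hγ t ht, hD x hx.2 y hy.2 γ hγ t ht⟩

theorem dist_sq_proj_le {C : Set X} (hC : GeoConvex C) {x p y : X} (hp : p ∈ C) (hy : y ∈ C)
    (hxp : dist x p ≤ infDist x C) : dist x p ^ 2 + dist p y ^ 2 ≤ dist x y ^ 2 := by
  refine le_of_forall_pos_le_add fun ε hε => ?_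
  obtain ⟨t, ht0, ht1, ht⟩ : ∃ t : ℝ, 0 < t ∧ t ≤ 1 ∧ t * dist p y ^ 2 ≤ ε := by
    refine ⟨min 1 (ε / (dist p y ^ 2 + 1)), by positivity, min_le_left _ _, ?_⟩
    calc _ ≤ ε / (dist p y ^ 2 + 1) * dist p y ^ 2 := by gcongr; exact min_le_right _ _
      _ ≤ ε := by
        rw [div_mul_eq_mul_div, div_le_iff₀ (by positivity)]; nlinarith
  have htm : t ∈ Icc (0:ℝ) 1 := ⟨ht0.le, ht1⟩
  have h1 := comparison_geo x p y htm
  have h2 : dist x p ≤ dist x (geo p y t) :=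
    hxp.trans (infDist_le_dist_of_mem (hC.geo_mem hp hy htm))
  have h3 : dist x p ^ 2 ≤ dist x (geo p y t) ^ 2 := by gcongr
  have h4 : t * (dist x p ^ 2 + dist p y ^ 2) ≤ t * (dist x y ^ 2 + t * dist p y ^ 2) := by
    nlinarith
  have := le_of_mul_le_mul_left h4 ht0
  linarith

theorem eq_of_dist_le_infDist {C : Set X} (hC : GeoConvex C) {x p q : X} (hp : p ∈ C)
    (hq : q ∈ C) (hxp : dist x p ≤ infDist x C) (hxq : dist x q ≤ infDist x C) : p = q := by
  have h := dist_sq_proj_le hC hp hq hxp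
  have h2 : dist x q ^ 2 ≤ dist x p ^ 2 := by
    gcongr; exact hxq.trans (infDist_le_dist_of_mem hp)
  exact dist_eq_zero.1 (pow_eq_zero_iff (two_ne_zero) |>.1
    (le_antisymm (by linarith) (sq_nonneg (dist p q))))

end Projection


/-- A geodesic ray parametrised with constant, possibly zero, speed. -/
structure LinRay (X : Type u) [MetricSpace X] where
  toFun : ℝ → X
  speed : ℝ
  speed_nonneg : 0 ≤ speed
  dist_eq : ∀ s, 0 ≤ s → ∀ t, 0 ≤ t → dist (toFun s) (toFun t) = speed * |s - t|

namespace LinRay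
section Basic
variable [MetricSpace X]

instance : CoeFun (LinRay X) (fun _ => ℝ → X) := ⟨LinRay.toFun⟩

/-- The constant ray at a point. -/
def const (x : X) : LinRay X := ⟨fun _ => x, 0, le_rfl, fun _ _ _ _ => by simp⟩

/-- Time rescaling of a ray. -/
def scale (a : ℝ) (u : LinRay X) : LinRay X :=
  ⟨fun t => u (|a| * t), |a| * u.speed, mul_nonneg (abs_nonneg a) u.speed_nonneg,
    fun s hs t ht => by
      rw [u.dist_eq _ (mul_nonneg (abs_nonneg a) hs) _ (mul_nonneg (abs_nonneg a) ht), ← mul_sub,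
        abs_mul, abs_abs]
      ring⟩

/-- The image of a ray under an isometry. -/
def map (g : X ≃ᵢ X) (u : LinRay X) : LinRay X :=
  ⟨fun t => g (u t), u.speed, u.speed_nonneg, fun s hs t ht => by
    rw [g.isometry.dist_eq, u.dist_eq s hs t ht]⟩

theorem dist_zero_apply (u : LinRay X) {t : ℝ} (ht : 0 ≤ t) : dist (u 0) (u t) = u.speed * t := by
  rw [u.dist_eq 0 le_rfl t ht, zero_sub, abs_neg, abs_of_nonneg ht]

end Basic

section CAT0
variable [MetricSpace X] [CAT0Space X]

theorem eq_geo (u : LinRay X) {s t : ℝ} (hs : 0 ≤ s) (hst : s ≤ t) (ht : 0 < t) :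
    u s = geo (u 0) (u t) (s / t) := by
  have hm : s / t ∈ Icc (0:ℝ) 1 := ⟨by positivity, (div_le_one ht).2 hst⟩
  apply eq_geo_of_dist hm
  · rw [u.dist_zero_apply hs, u.dist_zero_apply ht.le]
    apply le_of_eq; field_simp
  · rw [u.dist_eq t ht.le s hs, u.dist_zero_apply ht.le, abs_of_nonneg (by linarith)]
    apply le_of_eq; field_simp

theorem dist_le_of_le (u v : LinRay X) {s t : ℝ} (hs : 0 ≤ s) (hst : s ≤ t) (ht : 0 < t) :
    dist (u s) (v s) ≤ (1 - s / t) * dist (u 0) (v 0) + s / t * dist (u t) (v t) := by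
  rw [u.eq_geo hs hst ht, v.eq_geo hs hst ht]
  exact dist_geo_geo _ _ _ _ ⟨by positivity, (div_le_one ht).2 hst⟩

omit [CAT0Space X] in
theorem dist_upper (u v : LinRay X) {t : ℝ} (ht : 0 ≤ t) :
    dist (u t) (v t) ≤ dist (u 0) (v 0) + t * (u.speed + v.speed) := by
  have h1 := u.dist_zero_apply ht
  have h2 := v.dist_zero_apply ht
  have h3 := dist_triangle4 (u t) (u 0) (v 0) (v t)
  rw [dist_comm (u t) (u 0)] at h3
  linarith

theorem exists_tendsto (u v : LinRay X) :
    ∃ L, Tendsto (fun t => dist (u t) (v t) / t) atTop (nhds L) ∧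
      ∀ t, 0 ≤ t → dist (u t) (v t) ≤ dist (u 0) (v 0) + t * L := by
  set g : ℝ → ℝ := fun t => (dist (u t) (v t) - dist (u 0) (v 0)) / t with hg
  have hmono : ∀ s t, 0 < s → s ≤ t → g s ≤ g t := by
    intro s t hs hst
    have ht : 0 < t := hs.trans_le hst
    have h := dist_le_of_le u v hs.le hst ht
    rw [hg]
    simp only
    rw [div_le_div_iff₀ hs ht]
    have e : ((1 - s / t) * dist (u 0) (v 0) + s / t * dist (u t) (v t)) * t =
        (t - s) * dist (u 0) (v 0) + s * dist (u t) (v t) := by field_simp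
    linarith [mul_le_mul_of_nonneg_right h ht.le]
  have hM : Monotone fun t => g (max t 1) := fun a b hab =>
    hmono _ _ (by positivity) (max_le_max_right 1 hab)
  have hbd : ∀ t, 0 < t → g t ≤ u.speed + v.speed := fun t ht => by
    rw [hg]; simp only; rw [div_le_iff₀ ht]; linarith [dist_upper u v ht.le]
  have hB : BddAbove (range fun t => g (max t 1)) :=
    ⟨u.speed + v.speed, by rintro _ ⟨t, rfl⟩; exact hbd _ (by positivity)⟩
  have hlim := tendsto_atTop_ciSup hM hB
  set L := ⨆ t, g (max t 1)
  refine ⟨L, ?_, ?_⟩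
  · have h0 : Tendsto (fun t : ℝ => dist (u 0) (v 0) / t) atTop (nhds 0) :=
      tendsto_const_nhds.div_atTop tendsto_id
    have h1 := hlim.add h0
    rw [add_zero] at h1
    refine h1.congr' ?_
    filter_upwards [eventually_ge_atTop 1] with t ht
    rw [max_eq_left ht, hg]
    simp only
    rw [← add_div, sub_add_cancel]
  · intro t ht
    rcases ht.eq_or_lt with rfl | ht
    · simp
    have h1 : g t ≤ g (max t 1) := hmono _ _ ht (le_max_left _ _)
    have h2 : g t ≤ L := h1.trans (le_ciSup hB t)
    rw [hg] at h2
    simp only at h2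
    rw [div_le_iff₀ ht] at h2
    linarith

/-- Asymptotic distance between rays: the growth rate of the distance. -/
noncomputable def asDist (u v : LinRay X) : ℝ := Classical.choose (exists_tendsto u v)

theorem tendsto_asDist (u v : LinRay X) :
    Tendsto (fun t => dist (u t) (v t) / t) atTop (nhds (asDist u v)) :=
  (Classical.choose_spec (exists_tendsto u v)).1

theorem dist_le_asDist (u v : LinRay X) {t : ℝ} (ht : 0 ≤ t) :
    dist (u t) (v t) ≤ dist (u 0) (v 0) + t * asDist u v :=
  (Classical.choose_spec (exists_tendsto u v)).2 t ht

theorem asDist_eq_of_tendsto {u v : LinRay X} {L : ℝ}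
    (h : Tendsto (fun t => dist (u t) (v t) / t) atTop (nhds L)) : asDist u v = L :=
  tendsto_nhds_unique (tendsto_asDist u v) h

theorem asDist_le_of_forall {u v : LinRay X} {C L : ℝ}
    (h : ∀ t, 0 ≤ t → dist (u t) (v t) ≤ C + t * L) : asDist u v ≤ L := by
  have h0 : Tendsto (fun t : ℝ => C / t + L) atTop (nhds (0 + L)) :=
    (tendsto_const_nhds.div_atTop tendsto_id).add tendsto_const_nhds
  rw [zero_add] at h0
  refine le_of_tendsto_of_tendsto (tendsto_asDist u v) h0 ?_
  filter_upwards [eventually_gt_atTop 0] with t ht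
  rw [div_le_iff₀ ht, add_mul, div_mul_cancel₀ _ ht.ne']
  linarith [h t ht.le]

noncomputable instance : PseudoMetricSpace (LinRay X) where
  dist := asDist
  dist_self u := asDist_eq_of_tendsto (by simp)
  dist_comm u v := asDist_eq_of_tendsto (by
    simpa only [dist_comm] using tendsto_asDist v u)
  dist_triangle u v w := asDist_le_of_forall (C := dist (u 0) (v 0) + dist (v 0) (w 0))
    fun t ht => by
      linarith [dist_triangle (u t) (v t) (w t), dist_le_asDist u v ht, dist_le_asDist v w ht]

theorem tendsto_dist (u v : LinRay X) :
    Tendsto (fun t => dist (u t) (v t) / t) atTop (nhds (dist u v)) := tendsto_asDist u v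

theorem tendsto_dist_nat (u v : LinRay X) :
    Tendsto (fun n : ℕ => dist (u n) (v n) / n) atTop (nhds (dist u v)) :=
  (tendsto_asDist u v).comp tendsto_natCast_atTop_atTop

theorem dist_apply_le (u v : LinRay X) {t : ℝ} (ht : 0 ≤ t) :
    dist (u t) (v t) ≤ dist (u 0) (v 0) + t * dist u v := dist_le_asDist u v ht

theorem dist_eq_of_tendsto {u v : LinRay X} {L : ℝ}
    (h : Tendsto (fun t => dist (u t) (v t) / t) atTop (nhds L)) : dist u v = L :=
  asDist_eq_of_tendsto h

theorem dist_le_of_forall {u v : LinRay X} {C L : ℝ}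
    (h : ∀ t, 0 ≤ t → dist (u t) (v t) ≤ C + t * L) : dist u v ≤ L := asDist_le_of_forall h

theorem dist_eq_zero_of_bounded {u v : LinRay X} {C : ℝ}
    (h : ∀ t, 0 ≤ t → dist (u t) (v t) ≤ C) : dist u v = 0 :=
  le_antisymm (dist_le_of_forall (C := C) (L := 0) fun t ht => by simpa using h t ht) dist_nonneg

theorem dist_apply_le_of_dist_eq_zero {u v : LinRay X} (h : dist u v = 0) {t : ℝ} (ht : 0 ≤ t) :
    dist (u t) (v t) ≤ dist (u 0) (v 0) := by simpa [h] using dist_apply_le u v ht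

theorem dist_congr {u u' v v' : LinRay X} (hu : dist u u' = 0) (hv : dist v v' = 0) :
    dist u v = dist u' v' := by
  apply le_antisymm
  · linarith [dist_triangle4 u u' v' v, dist_comm v v']
  · linarith [dist_triangle4 u' u v v', dist_comm u u']

theorem dist_const (u : LinRay X) (x : X) : dist u (const x) = u.speed := by
  apply le_antisymm
  · refine dist_le_of_forall (C := dist (u 0) x) fun t ht => ?_
    have := dist_triangle (u t) (u 0) x
    rw [dist_comm (u t) (u 0), u.dist_zero_apply ht] at this
    simp only [const]
    linarith
  · have h : ∀ t, 0 ≤ t → t * u.speed ≤ 2 * dist (u 0) x + t * dist u (const x) := by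
      intro t ht
      have h1 := dist_apply_le u (const x) ht
      have h2 := dist_triangle (u 0) x (u t)
      rw [u.dist_zero_apply ht, dist_comm x] at h2
      simp only [const] at h1 ⊢
      linarith
    by_contra hcon
    push Not at hcon
    set e := u.speed - dist u (const x) with he
    have he0 : 0 < e := by linarith
    have := h ((2 * dist (u 0) x + 1) / e) (by positivity)
    have e1 : (2 * dist (u 0) x + 1) / e * e = 2 * dist (u 0) x + 1 := by field_simp
    nlinarith

theorem dist_speed (u v : LinRay X) : |u.speed - v.speed| ≤ dist u v := by
  have h1 := dist_const u (u 0)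
  have h2 := dist_const v (u 0)
  rw [← h1, ← h2]
  exact abs_dist_sub_le _ _ _

theorem speed_congr {u v : LinRay X} (h : dist u v = 0) : u.speed = v.speed := by
  have := dist_speed u v
  rw [h] at this
  exact sub_eq_zero.1 (abs_eq_zero.1 (le_antisymm this (abs_nonneg _)))

theorem dist_scale_scale (a : ℝ) (u v : LinRay X) :
    dist (scale a u) (scale a v) = |a| * dist u v := by
  rcases eq_or_ne a 0 with rfl | ha
  · rw [abs_zero, zero_mul]
    refine dist_eq_zero_of_bounded (C := dist (u 0) (v 0)) fun t ht => ?_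
    simp [scale]
  · have ha' : 0 < |a| := abs_pos.2 ha
    apply dist_eq_of_tendsto
    have := ((tendsto_dist u v).comp (tendsto_id.const_mul_atTop ha')).const_mul |a|
    refine this.congr' ?_
    filter_upwards [eventually_gt_atTop 0] with t ht
    simp only [Function.comp, scale, id]
    field_simp

theorem dist_scale_left (a b : ℝ) (u : LinRay X) :
    dist (scale a u) (scale b u) = |(|a| - |b|)| * u.speed := by
  apply dist_eq_of_tendsto
  refine (tendsto_const_nhds (x := |(|a| - |b|)| * u.speed)).congr' ?_
  filter_upwards [eventually_gt_atTop 0] with t ht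
  simp only [scale]
  rw [u.dist_eq _ (by positivity) _ (by positivity), ← sub_mul, abs_mul, abs_of_pos ht]
  field_simp

theorem dist_map_map (g : X ≃ᵢ X) (u v : LinRay X) : dist (map g u) (map g v) = dist u v := by
  apply dist_eq_of_tendsto
  simpa [map, g.isometry.dist_eq] using tendsto_dist u v

theorem dist_scale_scale_comp (a b : ℝ) (u : LinRay X) :
    dist (scale a (scale b u)) (scale (a * b) u) = 0 := by
  refine dist_eq_zero_of_bounded (C := 0) fun t ht => ?_
  simp only [scale]
  rw [abs_mul, mul_left_comm, mul_assoc, dist_self]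

theorem dist_scale_one (u : LinRay X) : dist (scale 1 u) u = 0 := by
  refine dist_eq_zero_of_bounded (C := 0) fun t ht => ?_
  simp [scale]

end CAT0
end LinRay


theorem nonpos_of_forall_mul_le {c C : ℝ}
    (h : ∀ R : ℝ, 0 < R → R * c ≤ C) : c ≤ 0 := by
  by_contra hc
  push Not at hc
  have := h ((|C| + 1) / c) (by positivity)
  rw [div_mul_cancel₀ _ hc.ne'] at this
  linarith [le_abs_self C]

namespace LinRay
section Inner
variable [MetricSpace X] [CAT0Space X]

/-- The inner product on the asymptotic cone of rays. -/
noncomputable def ip (u v : LinRay X) : ℝ := (u.speed ^ 2 + v.speed ^ 2 - dist u v ^ 2) / 2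

theorem ip_comm (u v : LinRay X) : ip u v = ip v u := by
  simp only [ip, dist_comm u v]; ring

theorem ip_self (u : LinRay X) : ip u u = u.speed ^ 2 := by simp [ip]

theorem ip_congr {u u' v v' : LinRay X} (hu : dist u u' = 0) (hv : dist v v' = 0) :
    ip u v = ip u' v' := by
  simp only [ip, dist_congr hu hv, speed_congr hu, speed_congr hv]

theorem dist_sq_eq (u v : LinRay X) :
    dist u v ^ 2 = u.speed ^ 2 + v.speed ^ 2 - 2 * ip u v := by
  simp only [ip]; ring

theorem ip_le (u v : LinRay X) : ip u v ≤ u.speed * v.speed := by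
  have := sq_le_sq' (by linarith [dist_nonneg (x := u) (y := v), abs_nonneg (u.speed - v.speed)])
    (dist_speed u v)
  rw [sq_abs] at this
  simp only [ip]
  nlinarith

theorem neg_le_ip (u v : LinRay X) : -(u.speed * v.speed) ≤ ip u v := by
  have h := dist_triangle u (const (u 0)) v
  rw [dist_const, dist_comm (const _) v, dist_const] at h
  have : dist u v ^ 2 ≤ (u.speed + v.speed) ^ 2 := by gcongr
  simp only [ip]
  nlinarith

theorem ip_map_map (g : X ≃ᵢ X) (u v : LinRay X) : ip (map g u) (map g v) = ip u v := by
  simp only [ip, dist_map_map]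
  rfl

theorem tendsto_dist_point (u : LinRay X) (x : X) :
    Tendsto (fun t => dist x (u t) / t) atTop (nhds u.speed) := by
  have := tendsto_dist (const x) u
  rwa [dist_comm, dist_const] at this

theorem dist_scale_sq_le (u v : LinRay X) {a : ℝ} (ha : a ∈ Icc (0:ℝ) 1) :
    dist (scale a u) v ^ 2 ≤
      (1 - a) * v.speed ^ 2 + a * dist u v ^ 2 - a * (1 - a) * u.speed ^ 2 := by
  have h1 := (tendsto_dist (scale a u) v).pow 2
  have h2 := ((((tendsto_dist_point v (u 0)).pow 2).const_mul (1 - a)).add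
    (((tendsto_dist u v).pow 2).const_mul a)).sub
    (((tendsto_dist_point u (u 0)).pow 2).const_mul (a * (1 - a)))
  refine le_of_tendsto_of_tendsto h1 h2 ?_
  filter_upwards [eventually_gt_atTop 0] with t ht
  have hat : a * t ≤ t := by nlinarith [ha.2]
  have e := u.eq_geo (mul_nonneg ha.1 ht.le) hat ht
  rw [mul_div_assoc, div_self ht.ne', mul_one] at e
  have c := comparison_geo (v t) (u 0) (u t) ha
  rw [← e, dist_comm (v t), dist_comm (v t), dist_comm (v t)] at c
  have e2 : (scale a u) t = u (a * t) := by simp only [scale, abs_of_nonneg ha.1]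
  simp only [e2, div_pow]
  rw [← mul_div_assoc, ← mul_div_assoc, ← mul_div_assoc, ← add_div, ← sub_div]
  gcongr

theorem ip_scale_scale_same {a : ℝ} (u v : LinRay X) :
    ip (scale a u) (scale a v) = a ^ 2 * ip u v := by
  have e (w : LinRay X) : (scale a w).speed = |a| * w.speed := rfl
  simp only [ip, dist_scale_scale, mul_pow, sq_abs, e]
  ring

theorem mul_ip_le_ip_scale {a : ℝ} (ha : a ∈ Icc (0:ℝ) 1) (u v : LinRay X) :
    a * ip u v ≤ ip (scale a u) v := by
  have h := dist_scale_sq_le u v ha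
  have e : (scale a u).speed = a * u.speed := by simp only [scale, abs_of_nonneg ha.1]
  simp only [ip, e]
  nlinarith

theorem ip_scale_left_of_le_one {a : ℝ} (ha : a ∈ Icc (0:ℝ) 1) (u v : LinRay X) :
    ip (scale a u) v = a * ip u v := by
  rcases ha.1.eq_or_lt with rfl | ha0
  · have h1 : (scale 0 u).speed = 0 := by simp [scale]
    have h2 := ip_le (scale 0 u) v
    have h3 := neg_le_ip (scale 0 u) v
    rw [h1] at h2 h3
    linarith
  · refine le_antisymm ?_ (mul_ip_le_ip_scale ha u v)
    have h := mul_ip_le_ip_scale ha v (scale a u)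
    rw [ip_scale_scale_same, ip_comm v (scale a u), ip_comm v u] at h
    exact le_of_mul_le_mul_left (by linarith) ha0

theorem ip_scale_left {a : ℝ} (ha : 0 ≤ a) (u v : LinRay X) :
    ip (scale a u) v = a * ip u v := by
  rcases le_or_gt a 1 with h1 | h1
  · exact ip_scale_left_of_le_one ⟨ha, h1⟩ u v
  · have hm : a⁻¹ ∈ Icc (0:ℝ) 1 := ⟨by positivity, inv_le_one_of_one_le₀ h1.le⟩
    have h := ip_scale_left_of_le_one hm (scale a u) v
    have ha0 : a ≠ 0 := by positivity
    have e : dist (scale a⁻¹ (scale a u)) u = 0 := by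
      refine dist_eq_zero_of_bounded (C := 0) fun t ht => ?_
      simp only [scale]
      rw [← mul_assoc, ← abs_mul, mul_inv_cancel₀ ha0]
      simp
    rw [ip_congr e (dist_self v)] at h
    rw [h]; field_simp

theorem ip_scale_right {a : ℝ} (ha : 0 ≤ a) (u v : LinRay X) :
    ip u (scale a v) = a * ip u v := by
  rw [ip_comm, ip_scale_left ha, ip_comm]

theorem ip_sub_le (p u v : LinRay X) : ip p u - ip p v ≤ p.speed * dist u v := by
  have key : ∀ R : ℝ, 0 < R → R * (2 * (ip p u - ip p v - p.speed * dist u v)) ≤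
      dist u v * (u.speed + v.speed) + u.speed ^ 2 - v.speed ^ 2 := by
    intro R hR
    have h1 := dist_sq_eq (scale R p) u
    have h2 := dist_sq_eq (scale R p) v
    rw [ip_scale_left hR.le] at h1 h2
    have h3 := dist_triangle (scale R p) u v
    have e : (scale R p).speed = R * p.speed := by simp only [scale, abs_of_pos hR]
    have h4 : dist (scale R p) u ≤ R * p.speed + u.speed := by
      have := dist_triangle (scale R p) (const (u 0)) u
      rwa [dist_const, dist_comm (const _) u, dist_const, e] at this
    have h5 : dist (scale R p) v ≤ R * p.speed + v.speed := by
      have := dist_triangle (scale R p) (const (u 0)) v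
      rwa [dist_const, dist_comm (const _) v, dist_const, e] at this
    have h6 : dist (scale R p) v ^ 2 - dist (scale R p) u ^ 2 ≤
        dist u v * (2 * R * p.speed + u.speed + v.speed) := by
      have : dist (scale R p) v ^ 2 - dist (scale R p) u ^ 2 =
        (dist (scale R p) v - dist (scale R p) u) * (dist (scale R p) v + dist (scale R p) u) := by
        ring
      rw [this]
      apply mul_le_mul <;> first | linarith | positivity
    nlinarith
  have := nonpos_of_forall_mul_le key
  linarith

theorem abs_ip_sub_le (p u v : LinRay X) : |ip p u - ip p v| ≤ p.speed * dist u v := by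
  rw [abs_le]
  have h1 := ip_sub_le p u v
  have h2 := ip_sub_le p v u
  rw [dist_comm v u] at h2
  constructor <;> linarith

end Inner

section Limit
variable [MetricSpace X] [CAT0Space X]

theorem exists_limit [ProperSpace X] (x₀ : X) (x : ℕ → X) (R : ℕ → ℝ) (M : ℝ)
    (hR : Tendsto R atTop atTop) (hM : ∀ᶠ n in atTop, dist x₀ (x n) ≤ M * R n) :
    ∃ u : LinRay X, ∀ s, 0 ≤ s →
      Tendsto (fun n => geo x₀ (x n) (s / R n)) (hyperfilter ℕ : Filter ℕ) (nhds (u s)) := by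
  have hmem : ∀ s, 0 ≤ s → ∀ᶠ n in (hyperfilter ℕ : Filter ℕ), s / R n ∈ Icc (0:ℝ) 1 := by
    intro s hs
    refine Nat.hyperfilter_le_atTop ?_
    filter_upwards [hR.eventually_ge_atTop (max s 1)] with n hn
    have h1 : 0 < R n := by linarith [le_max_right s 1]
    exact ⟨by positivity, (div_le_one h1).2 ((le_max_left _ _).trans hn)⟩
  have hpos : ∀ᶠ n in (hyperfilter ℕ : Filter ℕ), 0 < R n :=
    Nat.hyperfilter_le_atTop (hR.eventually_gt_atTop 0)
  have hM' := Nat.hyperfilter_le_atTop hM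
  have hlim : ∀ s, 0 ≤ s → ∃ y, Tendsto (fun n => geo x₀ (x n) (s / R n))
      (hyperfilter ℕ : Filter ℕ) (nhds y) := by
    intro s hs
    have : ((hyperfilter ℕ).map (fun n => geo x₀ (x n) (s / R n)) : Filter X) ≤
        Filter.principal (closedBall x₀ (s * M)) := by
      rw [Filter.le_principal_iff]
      simp only [Ultrafilter.coe_map, Filter.mem_map]
      filter_upwards [hmem s hs, hpos, hM'] with n h1 h2 h3
      rw [mem_preimage, mem_closedBall, dist_comm, dist_left_geo _ _ h1]
      calc s / R n * dist x₀ (x n) ≤ s / R n * (M * R n) := by gcongr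
        _ = s * M := by field_simp
    obtain ⟨y, -, hy⟩ := (isCompact_closedBall x₀ (s * M)).ultrafilter_le_nhds _ this
    exact ⟨y, hy⟩
  obtain ⟨r, ⟨hr0, -⟩, hr⟩ : ∃ r, r ∈ Icc 0 M ∧
      Tendsto (fun n => dist x₀ (x n) / R n) (hyperfilter ℕ : Filter ℕ) (nhds r) := by
    have : ((hyperfilter ℕ).map (fun n => dist x₀ (x n) / R n) : Filter ℝ) ≤
        Filter.principal (Icc 0 M) := by
      rw [Filter.le_principal_iff]
      simp only [Ultrafilter.coe_map, Filter.mem_map]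
      filter_upwards [hpos, hM'] with n h2 h3
      exact ⟨by positivity, (div_le_iff₀ h2).2 h3⟩
    exact isCompact_Icc.ultrafilter_le_nhds _ this
  have : Nonempty X := ⟨x₀⟩
  choose! f hf using hlim
  refine ⟨⟨f, r, hr0, fun s hs t ht => ?_⟩, hf⟩
  have h1 := (hf s hs).dist (hf t ht)
  have h2 := hr.mul_const |s - t|
  refine tendsto_nhds_unique h1 (h2.congr' ?_)
  filter_upwards [hmem s hs, hmem t ht, hpos] with n hs' ht' hp
  rw [(geo_seg x₀ (x n)).2.2 _ hs' _ ht', ← sub_div, abs_div, abs_of_pos hp]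
  ring

theorem limit_zero {x₀ : X} {x : ℕ → X} {R : ℕ → ℝ} {u : LinRay X}
    (hu : ∀ s, 0 ≤ s →
      Tendsto (fun n => geo x₀ (x n) (s / R n)) (hyperfilter ℕ : Filter ℕ) (nhds (u s))) :
    u 0 = x₀ := by
  have h := hu 0 le_rfl
  simp only [zero_div, geo_zero] at h
  exact tendsto_nhds_unique h tendsto_const_nhds

theorem dist_limit_apply_le {x₀ : X} {x : ℕ → X} {R : ℕ → ℝ} {u : LinRay X}
    (hR : Tendsto R atTop atTop)
    (hu : ∀ s, 0 ≤ s →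
      Tendsto (fun n => geo x₀ (x n) (s / R n)) (hyperfilter ℕ : Filter ℕ) (nhds (u s)))
    (p : LinRay X) {L : ℝ}
    (hL : ∀ᶠ n in (hyperfilter ℕ : Filter ℕ), dist (p (R n)) (x n) ≤ L * R n) {s : ℝ}
    (hs : 0 ≤ s) : dist (p s) (u s) ≤ dist (p 0) x₀ + s * L := by
  refine le_of_tendsto (tendsto_const_nhds.dist (hu s hs)) ?_
  filter_upwards [hL, Nat.hyperfilter_le_atTop (hR.eventually_ge_atTop (max s 1))] with n hn hRn
  have h1 : 0 < R n := by linarith [le_max_right s 1]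
  have h2 : s ≤ R n := (le_max_left _ _).trans hRn
  have hm : s / R n ∈ Icc (0:ℝ) 1 := ⟨by positivity, (div_le_one h1).2 h2⟩
  rw [p.eq_geo hs h2 h1]
  have h3 := dist_geo_geo (p 0) (p (R n)) x₀ (x n) hm
  have h4 : s / R n * dist (p (R n)) (x n) ≤ s * L := by
    calc _ ≤ s / R n * (L * R n) := by gcongr
      _ = s * L := by field_simp
  nlinarith [mul_nonneg hm.1 (dist_nonneg (x := p 0) (y := x₀))]

theorem dist_limit_le {x₀ : X} {x : ℕ → X} {R : ℕ → ℝ} {u : LinRay X}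
    (hR : Tendsto R atTop atTop)
    (hu : ∀ s, 0 ≤ s →
      Tendsto (fun n => geo x₀ (x n) (s / R n)) (hyperfilter ℕ : Filter ℕ) (nhds (u s)))
    (p : LinRay X) {L : ℝ}
    (hL : ∀ᶠ n in (hyperfilter ℕ : Filter ℕ), dist (p (R n)) (x n) ≤ L * R n) :
    dist p u ≤ L :=
  dist_le_of_forall fun _ hs => dist_limit_apply_le hR hu p hL hs

variable [ProperSpace X]

theorem exists_asymptotic (x₀ : X) (u : LinRay X) :
    ∃ v : LinRay X, v 0 = x₀ ∧ dist u v = 0 ∧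
      ∀ s, 0 ≤ s → Tendsto (fun n : ℕ => geo x₀ (u n) (s / n)) (hyperfilter ℕ : Filter ℕ)
        (nhds (v s)) := by
  have hR : Tendsto (fun n : ℕ => (n:ℝ)) atTop atTop := tendsto_natCast_atTop_atTop
  obtain ⟨v, hv⟩ := exists_limit x₀ (fun n => u n) (fun n => n) (dist x₀ (u 0) + u.speed) hR (by
    filter_upwards [eventually_ge_atTop 1] with n hn
    have h1 := dist_triangle x₀ (u 0) (u n)
    rw [u.dist_zero_apply (Nat.cast_nonneg n)] at h1
    have : (1:ℝ) ≤ n := by exact_mod_cast hn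
    nlinarith [dist_nonneg (x := x₀) (y := u 0)])
  refine ⟨v, limit_zero hv, le_antisymm ?_ dist_nonneg, hv⟩
  exact dist_limit_le hR hv u (L := 0) (by simp)

theorem exists_midpoint (u v : LinRay X) :
    ∃ m : LinRay X, ∀ p : LinRay X,
      dist p m ^ 2 ≤ dist p u ^ 2 / 2 + dist p v ^ 2 / 2 - dist u v ^ 2 / 4 := by
  have hR : Tendsto (fun n : ℕ => (n:ℝ)) atTop atTop := tendsto_natCast_atTop_atTop
  have half : (1/2:ℝ) ∈ Icc (0:ℝ) 1 := by constructor <;> norm_num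
  set x : ℕ → X := fun n => geo (u n) (v n) (1/2)
  have cmp : ∀ (n : ℕ) (q : X), dist q (x n) ^ 2 ≤
      dist q (u n) ^ 2 / 2 + dist q (v n) ^ 2 / 2 - dist (u n) (v n) ^ 2 / 4 := by
    intro n q
    have := comparison_geo q (u n) (v n) half
    linarith
  have hsq : ∀ (p : LinRay X) (L : ℝ), 0 ≤ L →
      dist p u ^ 2 / 2 + dist p v ^ 2 / 2 - dist u v ^ 2 / 4 < L ^ 2 →
      ∀ᶠ n : ℕ in atTop, dist (p n) (x n) ≤ L * n := by
    intro p L hL0 hL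
    have h := ((((tendsto_dist_nat p u).pow 2).div_const 2).add
      (((tendsto_dist_nat p v).pow 2).div_const 2)).sub (((tendsto_dist_nat u v).pow 2).div_const 4)
    filter_upwards [h.eventually_lt_const hL, eventually_gt_atTop 0] with n hn hn0
    have hn1 : (0:ℝ) < n := by exact_mod_cast hn0
    have h1 := cmp n (p n)
    have h2 : (dist (p n) (x n)) ^ 2 ≤ (L * n) ^ 2 := by
      have e : dist (p n) (u n) ^ 2 / 2 + dist (p n) (v n) ^ 2 / 2 - dist (u n) (v n) ^ 2 / 4 =
        ((dist (p n) (u n) / n) ^ 2 / 2 + (dist (p n) (v n) / n) ^ 2 / 2 -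
          (dist (u n) (v n) / n) ^ 2 / 4) * n ^ 2 := by field_simp
      rw [e] at h1
      rw [mul_pow]
      exact h1.trans (mul_le_mul_of_nonneg_right hn.le (by positivity))
    exact le_of_sq_le_sq h2 (by positivity)
  obtain ⟨m, hm⟩ := exists_limit (u 0) x (fun n => n) (u.speed + v.speed + 1) hR (by
    have h := hsq (const (u 0)) (u.speed + v.speed + 1)
      (by linarith [u.speed_nonneg, v.speed_nonneg]) (by
        rw [dist_comm, dist_const, dist_comm, dist_const]
        nlinarith [u.speed_nonneg, v.speed_nonneg, sq_nonneg (dist u v),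
          mul_nonneg u.speed_nonneg v.speed_nonneg])
    exact h)
  refine ⟨m, fun p => ?_⟩
  refine le_of_forall_pos_le_add fun ε hε => ?_
  set Q := dist p u ^ 2 / 2 + dist p v ^ 2 / 2 - dist u v ^ 2 / 4 with hQ
  have hQ0 : 0 ≤ Q := by
    have := dist_triangle u p v
    rw [dist_comm u p] at this
    have h2 : dist u v ^ 2 ≤ (dist p u + dist p v) ^ 2 := by gcongr
    nlinarith [sq_nonneg (dist p u - dist p v)]
  have h := dist_limit_le hR hm p (L := Real.sqrt (Q + ε)) (Nat.hyperfilter_le_atTop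
    (hsq p _ (Real.sqrt_nonneg _) (by rw [Real.sq_sqrt (by linarith)]; linarith)))
  calc dist p m ^ 2 ≤ Real.sqrt (Q + ε) ^ 2 := by gcongr
    _ = Q + ε := Real.sq_sqrt (by linarith)

end Limit
end LinRay

namespace LinRay
section Add
variable [MetricSpace X] [CAT0Space X]

/-- The midpoint inequality of nonpositive curvature. -/
def IsMidpoint (m u v : LinRay X) : Prop :=
  ∀ p : LinRay X, dist p m ^ 2 ≤ dist p u ^ 2 / 2 + dist p v ^ 2 / 2 - dist u v ^ 2 / 4

theorem IsMidpoint.symm {m u v : LinRay X} (h : IsMidpoint m u v) : IsMidpoint m v u := fun p => by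
  have := h p
  rw [dist_comm v u]; linarith

theorem IsMidpoint.dist_left_sq {m u v : LinRay X} (h : IsMidpoint m u v) :
    dist m u ^ 2 ≤ dist u v ^ 2 / 4 := by
  have := h u
  rw [dist_self, dist_comm u m] at this
  linarith

theorem IsMidpoint.dist_right_sq {m u v : LinRay X} (h : IsMidpoint m u v) :
    dist m v ^ 2 ≤ dist u v ^ 2 / 4 := by
  rw [dist_comm u v]; exact h.symm.dist_left_sq

theorem IsMidpoint.dist_le_half {m m' u v v' : LinRay X} (h : IsMidpoint m u v)
    (h' : IsMidpoint m' u v') : dist m m' ≤ dist v v' / 2 := by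
  have h1 := h' m
  have h2 := h v'
  have h3 := h.dist_left_sq
  rw [dist_comm v' m, dist_comm v' u, dist_comm v' v] at h2
  apply le_of_sq_le_sq _ (by positivity)
  linarith

theorem IsMidpoint.speed_sq_le {m u v : LinRay X} (h : IsMidpoint m u v) :
    m.speed ^ 2 ≤ u.speed ^ 2 / 2 + v.speed ^ 2 / 2 - dist u v ^ 2 / 4 := by
  have := h (const (u 0))
  simpa only [dist_comm (const (u 0)), dist_const] using this

theorem IsMidpoint.ip_le {m u v : LinRay X} (h : IsMidpoint m u v) (p : LinRay X) :
    (ip p u + ip p v) / 2 ≤ ip p m := by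
  have key : ∀ R : ℝ, 0 < R → R * (ip p u + ip p v - 2 * ip p m) ≤
      u.speed ^ 2 / 2 + v.speed ^ 2 / 2 - dist u v ^ 2 / 4 - m.speed ^ 2 := by
    intro R hR
    have h1 := h (scale R p)
    simp only [dist_sq_eq (scale R p), ip_scale_left hR.le] at h1
    linarith
  have := nonpos_of_forall_mul_le key
  linarith

variable [ProperSpace X]

theorem exists_isMidpoint (u v : LinRay X) : ∃ m, IsMidpoint m u v := exists_midpoint u v

/-- Addition in the asymptotic cone. -/
noncomputable def add (u v : LinRay X) : LinRay X :=
  Classical.choose (exists_isMidpoint (scale 2 u) (scale 2 v))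

theorem isMidpoint_add (u v : LinRay X) : IsMidpoint (add u v) (scale 2 u) (scale 2 v) :=
  Classical.choose_spec (exists_isMidpoint (scale 2 u) (scale 2 v))

theorem ip_add_le (p u v : LinRay X) : ip p u + ip p v ≤ ip p (add u v) := by
  have := (isMidpoint_add u v).ip_le p
  rw [ip_scale_right zero_le_two, ip_scale_right zero_le_two] at this
  linarith

theorem dist_add_add_le (u v u' v' : LinRay X) :
    dist (add u v) (add u' v') ≤ dist u u' + dist v v' := by
  have h1 := (isMidpoint_add u v).dist_le_half (isMidpoint_add u v')
  have h2 := (isMidpoint_add u v').symm.dist_le_half (isMidpoint_add u' v').symm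
  rw [dist_scale_scale, abs_two] at h1 h2
  linarith [dist_triangle (add u v) (add u v') (add u' v')]

theorem dist_add_left_le (u v : LinRay X) : dist (add u v) u ≤ v.speed := by
  have h1 : dist (add u (const (u 0))) u ≤ 0 := by
    have h := isMidpoint_add u (const (u 0)) u
    have e1 : dist u (scale 2 u) = u.speed := by
      have := dist_scale_left 1 2 u
      rw [dist_congr (dist_scale_one u) (dist_self _)] at this
      rw [this]; norm_num
    have e2 (w : LinRay X) : dist w (scale 2 (const (u 0))) = w.speed := dist_const w (u 0)
    have e3 : (scale 2 u).speed = 2 * u.speed := by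
      change |(2:ℝ)| * u.speed = _
      rw [abs_two]
    rw [e1, e2, e2, e3] at h
    rw [dist_comm]
    exact le_of_sq_le_sq (by linarith) le_rfl
  have h2 := dist_add_add_le u v u (const (u 0))
  rw [dist_self, dist_const] at h2
  linarith [dist_triangle (add u v) (add u (const (u 0))) u]

theorem dist_scale_add (c : ℝ) (u v : LinRay X) :
    dist (scale c (add u v)) (add (scale c u) (scale c v)) = 0 := by
  have h := isMidpoint_add (scale c u) (scale c v) (scale c (add u v))
  have h1 := (isMidpoint_add u v).dist_left_sq
  have h2 := (isMidpoint_add u v).dist_right_sq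
  have e (w : LinRay X) : dist (scale 2 (scale c w)) (scale c (scale 2 w)) = 0 := by
    refine dist_eq_zero_of_bounded (C := 0) fun t _ => ?_
    simp only [scale]
    rw [mul_left_comm]; simp
  rw [dist_congr (dist_self (scale c (add u v))) (e u),
    dist_congr (dist_self (scale c (add u v))) (e v), dist_congr (e u) (e v), dist_scale_scale,
    dist_scale_scale, dist_scale_scale, mul_pow, mul_pow, mul_pow, sq_abs] at h
  refine le_antisymm (le_of_sq_le_sq ?_ le_rfl) dist_nonneg
  nlinarith [mul_le_mul_of_nonneg_left h1 (sq_nonneg c), mul_le_mul_of_nonneg_left h2 (sq_nonneg c)]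

theorem speed_le_speed_add {u v : LinRay X} (h : 0 ≤ ip u v) : u.speed ≤ (add u v).speed := by
  have h1 := ip_add_le u u v
  have h2 := ip_le u (add u v)
  rw [ip_self] at h1
  rcases u.speed_nonneg.eq_or_lt with h0 | h0
  · rw [← h0]; exact (add u v).speed_nonneg
  · refine le_of_mul_le_mul_left ?_ h0
    linarith [sq u.speed]

instance : CompleteSpace (LinRay X) := by
  refine Metric.complete_of_cauchySeq_tendsto fun u hu => ?_
  set x₀ := u 0 0
  choose v hv0 hv _ using fun n => exists_asymptotic x₀ (u n)
  have hvv (n m : ℕ) : dist (v n) (v m) = dist (u n) (u m) := (dist_congr (hv n) (hv m)).symm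
  have hpt (n m : ℕ) {t : ℝ} (ht : 0 ≤ t) : dist (v n t) (v m t) ≤ t * dist (u n) (u m) := by
    have := dist_apply_le (v n) (v m) ht
    rwa [hv0, hv0, dist_self, zero_add, hvv] at this
  rw [Metric.cauchySeq_iff] at hu
  have hc : ∀ t, 0 ≤ t → ∃ y, Tendsto (fun n => v n t) atTop (nhds y) := by
    intro t ht
    refine cauchySeq_tendsto_of_complete (Metric.cauchySeq_iff.2 fun ε hε => ?_)
    obtain ⟨N, hN⟩ := hu (ε / (t + 1)) (by positivity)
    refine ⟨N, fun m hm n hn => (hpt m n ht).trans_lt ?_⟩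
    have := hN m hm n hn
    rw [lt_div_iff₀ (by positivity)] at this
    linarith [dist_nonneg (x := u m) (y := u n)]
  obtain ⟨r, hr⟩ : ∃ r, Tendsto (fun n => (v n).speed) atTop (nhds r) := by
    refine cauchySeq_tendsto_of_complete (Metric.cauchySeq_iff.2 fun ε hε => ?_)
    obtain ⟨N, hN⟩ := hu ε hε
    refine ⟨N, fun m hm n hn => ?_⟩
    rw [Real.dist_eq]
    exact (dist_speed _ _).trans_lt (by rw [hvv]; exact hN m hm n hn)
  have : Nonempty X := ⟨x₀⟩
  choose! f hf using hc
  let w : LinRay X := ⟨f, r, ge_of_tendsto' hr fun n => (v n).speed_nonneg, fun s hs t ht =>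
    tendsto_nhds_unique ((hf s hs).dist (hf t ht))
      ((hr.mul_const |s - t|).congr fun n => ((v n).dist_eq s hs t ht).symm)⟩
  refine ⟨w, Metric.tendsto_atTop'.2 fun ε hε => ?_⟩
  obtain ⟨N, hN⟩ := hu (ε / 2) (by positivity)
  refine ⟨N, fun n hn => ?_⟩
  have : dist (v n) w ≤ ε / 2 := by
    refine dist_le_of_forall (C := 0) fun t ht => ?_
    refine le_of_tendsto (tendsto_const_nhds.dist (hf t ht)) ?_
    filter_upwards [eventually_ge_atTop N] with m hm
    rw [zero_add]
    exact (hpt n m ht).trans (mul_le_mul_of_nonneg_left (hN n hn.le m hm).le ht)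
  rw [dist_congr (hv n) (dist_self w)]
  linarith

theorem exists_min_speed {A : Set (LinRay X)} (hne : A.Nonempty) (hcl : IsClosed A)
    (hmid : ∀ u ∈ A, ∀ v ∈ A, ∀ m, IsMidpoint m u v → m ∈ A) :
    ∃ v ∈ A, ∀ u ∈ A, v.speed ≤ u.speed := by
  set d := sInf (speed '' A)
  have hbd : BddBelow (speed '' A) := ⟨0, by rintro _ ⟨u, -, rfl⟩; exact u.speed_nonneg⟩
  have hd (u) (hu : u ∈ A) : d ≤ u.speed := csInf_le hbd ⟨u, hu, rfl⟩
  have hd0 : 0 ≤ d := Real.sInf_nonneg (by rintro _ ⟨u, -, rfl⟩; exact u.speed_nonneg)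
  have hex (n : ℕ) : ∃ u ∈ A, u.speed < d + 1 / (n + 1) := by
    obtain ⟨_, ⟨u, hu, rfl⟩, h⟩ := exists_lt_of_csInf_lt (hne.image speed)
      (show d < d + 1 / ((n:ℝ) + 1) by linarith [Nat.one_div_pos_of_nat (α := ℝ) (n := n)])
    exact ⟨u, hu, h⟩
  choose u huA hu using hex
  have hD (u) (hu : u ∈ A) (v) (hv : v ∈ A) :
      dist u v ^ 2 ≤ 2 * u.speed ^ 2 + 2 * v.speed ^ 2 - 4 * d ^ 2 := by
    obtain ⟨m, hm⟩ := exists_isMidpoint u v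
    have h1 := hm.speed_sq_le
    have h2 := hd m (hmid u hu v hv m hm)
    have h3 : d ^ 2 ≤ m.speed ^ 2 := by gcongr
    linarith
  have hsp : Tendsto (fun n => (u n).speed) atTop (nhds d) := by
    refine tendsto_of_tendsto_of_tendsto_of_le_of_le tendsto_const_nhds ?_
      (fun n => hd _ (huA n)) (fun n => (hu n).le)
    simpa using (tendsto_const_nhds (x := d)).add (tendsto_one_div_add_atTop_nhds_zero_nat (𝕜 := ℝ))
  have hsp2 : Tendsto (fun n => 4 * ((u n).speed ^ 2 - d ^ 2)) atTop (nhds 0) := by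
    have := ((hsp.pow 2).sub_const (d ^ 2)).const_mul 4
    rwa [sub_self, mul_zero] at this
  have hcau : CauchySeq u := by
    rw [Metric.cauchySeq_iff]
    intro ε hε
    obtain ⟨N, hN⟩ := eventually_atTop.1 (hsp2.eventually_lt_const (pow_pos hε 2))
    refine ⟨N, fun m hm n hn => ?_⟩
    refine lt_of_pow_lt_pow_left₀ 2 hε.le ((hD _ (huA m) _ (huA n)).trans_lt ?_)
    linarith [hN m hm, hN n hn]
  obtain ⟨w, hw⟩ := cauchySeq_tendsto_of_complete hcau
  refine ⟨w, hcl.mem_of_tendsto hw (Eventually.of_forall huA), fun x hx => ?_⟩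
  refine le_trans (le_of_eq ?_) (hd x hx)
  refine tendsto_nhds_unique (tendsto_iff_dist_tendsto_zero.2 ?_) hsp
  refine squeeze_zero (fun _ => dist_nonneg) (fun n => ?_) (tendsto_iff_dist_tendsto_zero.1 hw)
  rw [Real.dist_eq]
  exact dist_speed _ _

theorem dist_eq_zero_of_min_speed {A : Set (LinRay X)}
    (hmid : ∀ u ∈ A, ∀ v ∈ A, ∀ m, IsMidpoint m u v → m ∈ A) {u v : LinRay X} (hu : u ∈ A)
    (hv : v ∈ A) (hmin : ∀ w ∈ A, v.speed ≤ w.speed) (h : u.speed = v.speed) : dist u v = 0 := by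
  obtain ⟨m, hm⟩ := exists_isMidpoint u v
  have h1 := hm.speed_sq_le
  have h2 := hmin m (hmid u hu v hv m hm)
  have h3 : v.speed ^ 2 ≤ m.speed ^ 2 := by
    have := v.speed_nonneg
    gcongr
  rw [h] at h1
  exact pow_eq_zero_iff two_ne_zero |>.1 (le_antisymm (by linarith) (sq_nonneg _))

end Add
end LinRay

namespace LinRay
section Tits
variable [MetricSpace X]

/-- A unit speed ray as a ray of constant speed. -/
def ofRay (ρ : GeodesicRay X) : LinRay X :=
  ⟨ρ.toFun, 1, zero_le_one, fun s hs t ht => by rw [ρ.isom s hs t ht, one_mul]⟩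

/-- A ray of speed one as a geodesic ray. -/
def toRay (u : LinRay X) (hu : u.speed = 1) : GeodesicRay X :=
  ⟨u.toFun, fun s hs t ht => by rw [u.dist_eq s hs t ht, hu, one_mul]⟩

variable [CAT0Space X]

theorem cls_eq_cls_iff (ρ σ : GeodesicRay X) : ρ.cls = σ.cls ↔ dist (ofRay ρ) (ofRay σ) = 0 := by
  constructor
  · intro h
    obtain ⟨C, hC⟩ : ρ.Asymp σ := Quotient.exact h
    exact dist_eq_zero_of_bounded hC
  · exact fun h => Quotient.sound
      ⟨_, fun t ht => dist_apply_le_of_dist_eq_zero (u := ofRay ρ) (v := ofRay σ) h ht⟩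

/-- The cosine of the comparison angle at a common origin, for points at equal distance. -/
noncomputable def cosAt (u v : LinRay X) (t : ℝ) : ℝ := 1 - dist (u t) (v t) ^ 2 / (2 * t ^ 2)

theorem tendsto_cosAt {u v : LinRay X} (hu : u.speed = 1) (hv : v.speed = 1) :
    Tendsto (cosAt u v) atTop (nhds (ip u v)) := by
  have h := (((tendsto_dist u v).pow 2).div_const 2).const_sub 1
  have e : ip u v = 1 - dist u v ^ 2 / 2 := by simp only [ip, hu, hv]; ring
  rw [e]
  refine h.congr fun t => ?_
  rw [cosAt, div_pow, div_div, mul_comm]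

omit [CAT0Space X] in
theorem cosAt_mem {u v : LinRay X} (hu : u.speed = 1) (hv : v.speed = 1) (h0 : u 0 = v 0) {t : ℝ}
    (ht : 0 < t) : cosAt u v t ∈ Icc (-1:ℝ) 1 := by
  have h := dist_upper u v ht.le
  rw [h0, dist_self, hu, hv] at h
  have h2 : dist (u t) (v t) ^ 2 ≤ (t * 2) ^ 2 := by
    gcongr; linarith
  refine ⟨?_, ?_⟩
  · rw [cosAt, neg_le_sub_iff_le_add, div_le_iff₀ (by positivity)]
    linarith
  · rw [cosAt, sub_le_self_iff]
    positivity

theorem le_dist_apply_of_cosAt {u v : LinRay X} (hu : u.speed = 1) (hv : v.speed = 1)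
    (h0 : u 0 = v 0) {T r : ℝ} (hT : 0 < T) (hr : T ≤ r) :
    r - T * cosAt u v T ≤ dist (u T) (v r) := by
  have hr0 : 0 < r := hT.trans_le hr
  have h := comparison_geo (u T) (v 0) (v r) (t := T / r)
    ⟨by positivity, (div_le_one hr0).2 hr⟩
  rw [← v.eq_geo hT.le hr hr0, ← h0, dist_comm (u T) (u 0), h0, dist_zero_apply v hr0.le,
    ← h0, dist_zero_apply u hT.le, hu, hv] at h
  have e : dist (u T) (v T) ^ 2 = 2 * T ^ 2 * (1 - cosAt u v T) := by
    rw [cosAt]; field_simp; ring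
  obtain ⟨c1, c2⟩ := cosAt_mem hu hv h0 hT
  set c := cosAt u v T
  rw [e] at h
  have h2 : r * (2 * T ^ 2 * (1 - c)) ≤
      (r - T) * T ^ 2 + T * dist (u T) (v r) ^ 2 - T * (r - T) * r := by
    calc _ ≤ r * _ := mul_le_mul_of_nonneg_left h hr0.le
      _ = _ := by field_simp
  have h3 : r ^ 2 + T ^ 2 - 2 * r * T * c ≤ dist (u T) (v r) ^ 2 := by
    refine le_of_mul_le_mul_left ?_ hT
    linarith
  refine le_of_sq_le_sq ?_ dist_nonneg
  nlinarith [sq_nonneg T]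

theorem dist_ge_of_asymptotic {u v w : LinRay X} (hu : u.speed = 1) (hv : v.speed = 1)
    (h0 : u 0 = v 0) {T : ℝ} (hT : 0 < T)
    (hw : ∀ s, 0 ≤ s → Tendsto (fun n : ℕ => geo (u T) (v n) (s / n)) (hyperfilter ℕ : Filter ℕ)
        (nhds (w s))) {s t : ℝ} (hs : 0 < s) (ht : 0 ≤ t) :
    t - s * cosAt u v T ≤ dist (u (T + s)) (w t) := by
  set c := cosAt u v T
  have hlim : Tendsto (fun n : ℕ => t * (1 - T * c / n) - s * c) (hyperfilter ℕ : Filter ℕ)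
      (nhds (t * (1 - 0) - s * c)) :=
    ((tendsto_const_nhds.div_atTop tendsto_natCast_atTop_atTop).const_sub 1
      |>.const_mul t |>.sub_const (s * c)).mono_left Nat.hyperfilter_le_atTop
  rw [sub_zero, mul_one] at hlim
  refine le_of_tendsto_of_tendsto hlim (tendsto_const_nhds.dist (hw t ht))
    (Nat.hyperfilter_le_atTop ?_)
  filter_upwards [tendsto_natCast_atTop_atTop.eventually_ge_atTop (max T (max t 1))] with n hn
  have hnT : T ≤ n := (le_max_left _ _).trans hn
  have hnt : t ≤ n := ((le_max_left _ _).trans (le_max_right _ _)).trans hn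
  have hn0 : (0:ℝ) < n := hT.trans_le hnT
  have h1 := le_dist_apply_of_cosAt hu hv h0 hT hnT
  have hm : t / n ∈ Icc (0:ℝ) 1 := ⟨by positivity, (div_le_one hn0).2 hnt⟩
  have h2 := dist_right_geo (u T) (v n) hm
  have h3 := dist_triangle (u (T + s)) (geo (u T) (v n) (t / n)) (v n)
  rw [dist_comm (geo _ _ _) (v n), h2] at h3
  have h4 := dist_le_of_le u (const (v n)) hT.le (by linarith : T ≤ T + s) (by linarith)
  simp only [const] at h4
  rw [h0, dist_comm (v 0), dist_comm (v n), dist_zero_apply v hn0.le, hv] at h4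
  have h5 : (T + s) * dist (u T) (v n) ≤ s * n + T * dist (u (T + s)) (v n) := by
    have hTs : 0 < T + s := by linarith
    calc _ ≤ (T + s) * _ := mul_le_mul_of_nonneg_left h4 hTs.le
      _ = _ := by field_simp; ring
  have h6 : -(s * c) ≤ dist (u (T + s)) (v n) - dist (u T) (v n) := by
    refine le_of_mul_le_mul_left ?_ hT
    nlinarith [mul_le_mul_of_nonneg_left h1 hs.le]
  have h7 : t * (1 - T * c / n) ≤ t / n * dist (u T) (v n) := by
    calc _ = t / n * (n - T * c) := by field_simp
      _ ≤ _ := mul_le_mul_of_nonneg_left h1 hm.1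
  linarith

theorem dist_sq_ge_of_asymptotic {u v w : LinRay X} (hu : u.speed = 1) (hv : v.speed = 1)
    (h0 : u 0 = v 0) {T : ℝ} (hT : 0 < T) (hw0 : w 0 = u T) (hw1 : w.speed = 1)
    (hw : ∀ s, 0 ≤ s → Tendsto (fun n : ℕ => geo (u T) (v n) (s / n)) (hyperfilter ℕ : Filter ℕ)
        (nhds (w s))) {s t : ℝ} (hs : 0 < s) (ht : 0 < t) :
    s ^ 2 + t ^ 2 - 2 * s * t * cosAt u v T ≤ dist (u (T + s)) (w t) ^ 2 := by
  obtain ⟨c1, c2⟩ := cosAt_mem hu hv h0 hT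
  set c := cosAt u v T with hc
  have key (l : ℝ) (hl : 0 < l) (hl1 : l ≤ 1) (hlt : l * s ≤ t) :
      s ^ 2 + t ^ 2 - 2 * s * t * c - l * s ^ 2 ≤ dist (u (T + s)) (w t) ^ 2 := by
    have h1 := dist_ge_of_asymptotic hu hv h0 hT hw (mul_pos hl hs) ht.le
    rw [← hc] at h1
    have h2 : 0 ≤ t - l * s * c := by nlinarith [mul_pos hl hs]
    have e : u (T + l * s) = geo (u T) (u (T + s)) l := by
      have hd (a b : ℝ) (ha : 0 ≤ a) (hb : a ≤ b) : dist (u a) (u b) = b - a := by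
        rw [u.dist_eq a ha b (ha.trans hb), hu, abs_sub_comm, abs_of_nonneg (by linarith), one_mul]
      have : l * s ≤ s := by nlinarith
      have hls := mul_pos hl hs
      refine eq_geo_of_dist ⟨hl.le, hl1⟩ ?_ ?_
      · rw [hd _ _ hT.le (by linarith), hd _ _ hT.le (by linarith)]
        linarith
      · rw [dist_comm, hd _ _ (by linarith) (by linarith), hd _ _ hT.le (by linarith)]
        linarith
    have h3 := comparison_geo (w t) (u T) (u (T + s)) (t := l) ⟨hl.le, hl1⟩
    rw [← e, dist_comm (w t), dist_comm (w t), dist_comm (w t), ← hw0, w.dist_zero_apply ht.le, hw1,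
      hw0, u.dist_eq _ hT.le _ (by linarith), hu, sub_add_cancel_left, abs_neg, abs_of_pos hs] at h3
    have h4 : (t - l * s * c) ^ 2 ≤ dist (u (T + l * s)) (w t) ^ 2 := by gcongr
    refine le_of_mul_le_mul_left ?_ hl
    nlinarith [mul_nonneg hl.le (sq_nonneg (l * s * c)), sq_nonneg (l * s * c)]
  by_contra hcon
  push Not at hcon
  set g := s ^ 2 + t ^ 2 - 2 * s * t * c - dist (u (T + s)) (w t) ^ 2 with hg
  have hg0 : 0 < g := by linarith
  set l := min 1 (min (t / s) (g / (2 * s ^ 2))) with hl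
  have l0 : 0 < l := by positivity
  have l1 : l * s ≤ t := by
    rw [← le_div_iff₀ hs]; exact (min_le_right _ _).trans (min_le_left _ _)
  have l2 : l * (2 * s ^ 2) ≤ g := by
    rw [← le_div_iff₀ (by positivity)]; exact (min_le_right _ _).trans (min_le_right _ _)
  have := key l l0 (min_le_left _ _) l1
  linarith

theorem alexAngleRays_le (ρ σ : GeodesicRay X) (h0 : ρ.toFun 0 = σ.toFun 0) :
    alexAngleRays ρ.toFun σ.toFun ≤ Real.arccos (ip (ofRay ρ) (ofRay σ)) := by
  have hmem : cmpAngle (ρ.toFun 0) (ρ.toFun 1) (σ.toFun 1) ∈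
      {a | ∃ s, 0 < s ∧ ∃ t, 0 < t ∧ a = cmpAngle (ρ.toFun 0) (ρ.toFun s) (σ.toFun t)} :=
    ⟨1, one_pos, 1, one_pos, rfl⟩
  refine (csInf_le ⟨0, ?_⟩ hmem).trans (Real.arccos_le_arccos ?_)
  · rintro _ ⟨s, -, t, -, rfl⟩
    exact Real.arccos_nonneg _
  · have h1 := dist_apply_le (ofRay ρ) (ofRay σ) zero_le_one
    simp only [ofRay, h0, dist_self, zero_add, one_mul] at h1
    have h2 : dist (ρ.toFun 1) (σ.toFun 1) ^ 2 ≤ dist (ofRay ρ) (ofRay σ) ^ 2 := by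
      simp only [ofRay]; gcongr
    have h3 : dist (ρ.toFun 0) (ρ.toFun 1) = 1 := by
      rw [ρ.isom 0 le_rfl 1 zero_le_one]; norm_num
    have h4 : dist (ρ.toFun 0) (σ.toFun 1) = 1 := by
      rw [h0, σ.isom 0 le_rfl 1 zero_le_one]; norm_num
    rw [h3, h4]
    simp only [ip]
    simp only [ofRay] at h2 ⊢
    linarith

variable [ProperSpace X]

theorem titsAngle_cls (ρ σ : GeodesicRay X) :
    titsAngle ρ.cls σ.cls = Real.arccos (ip (ofRay ρ) (ofRay σ)) := by
  have hub : ∀ a ∈ {a | ∃ ρ' σ' : GeodesicRay X, ρ'.toFun 0 = σ'.toFun 0 ∧ ρ'.cls = ρ.cls ∧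
      σ'.cls = σ.cls ∧ a = alexAngleRays ρ'.toFun σ'.toFun},
      a ≤ Real.arccos (ip (ofRay ρ) (ofRay σ)) := by
    rintro _ ⟨ρ', σ', h0, hρ, hσ, rfl⟩
    rw [← ip_congr ((cls_eq_cls_iff _ _).1 hρ) ((cls_eq_cls_iff _ _).1 hσ)]
    exact alexAngleRays_le ρ' σ' h0
  obtain ⟨v, hv0, hv, -⟩ := exists_asymptotic (ρ.toFun 0) (ofRay σ)
  have hv1 : v.speed = 1 := (speed_congr hv).symm
  have hu1 : (ofRay ρ).speed = 1 := rfl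
  refine le_antisymm (Real.sSup_le hub (Real.arccos_nonneg _)) ?_
  rw [ip_congr (dist_self (ofRay ρ)) hv]
  refine le_of_tendsto ((Real.continuous_arccos.tendsto _).comp (tendsto_cosAt hu1 hv1)) ?_
  filter_upwards [eventually_gt_atTop 0] with T hT
  obtain ⟨w, hw0, hw, hwl⟩ := exists_asymptotic (ρ.toFun T) v
  have hw1 : w.speed = 1 := (speed_congr hw).symm.trans hv1
  let ρT : GeodesicRay X := ⟨fun s => ρ.toFun (T + s), fun s hs t ht => by
    rw [ρ.isom _ (by linarith) _ (by linarith), add_sub_add_left_eq_sub]⟩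
  have hρT : ρT.cls = ρ.cls := Quotient.sound ⟨T, fun t ht => by
    simp only [ρT]
    rw [ρ.isom _ (by linarith) _ ht, add_sub_cancel_right, abs_of_pos hT]⟩
  have hσ : (w.toRay hw1).cls = σ.cls := by
    rw [cls_eq_cls_iff]
    have : dist w (ofRay σ) = 0 := by
      rw [dist_comm, dist_congr hv (dist_self w)]; exact hw
    exact this
  refine le_trans ?_ (le_csSup ⟨_, hub⟩ ⟨ρT, w.toRay hw1, ?_, hρT, hσ, rfl⟩)
  swap
  · simp only [ρT, toRay, add_zero]; exact hw0.symm
  refine le_csInf ⟨_, 1, one_pos, 1, one_pos, rfl⟩ ?_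
  rintro _ ⟨s, hs, t, ht, rfl⟩
  refine Real.arccos_le_arccos ?_
  have h := dist_sq_ge_of_asymptotic hu1 hv1 hv0.symm hT hw0 hw1 hwl hs ht
  have h1 : dist (ρT.toFun 0) (ρT.toFun s) = s := by
    rw [ρT.isom 0 le_rfl s hs.le, zero_sub, abs_neg, abs_of_pos hs]
  have h2 : dist (ρT.toFun 0) ((w.toRay hw1).toFun t) = t := by
    have := w.dist_zero_apply ht.le
    rw [hw1, one_mul, hw0] at this
    simpa only [ρT, toRay, add_zero] using this
  rw [h1, h2, div_le_iff₀ (by positivity)]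
  have h3 : dist (ρT.toFun s) ((w.toRay hw1).toFun t) = dist ((ofRay ρ) (T + s)) (w t) := rfl
  rw [h3]
  linarith

theorem titsAngle_toRay {u v : LinRay X} (hu : u.speed = 1) (hv : v.speed = 1) :
    titsAngle (u.toRay hu).cls (v.toRay hv).cls = Real.arccos (ip u v) := by
  rw [titsAngle_cls]
  have (w : LinRay X) (hw : w.speed = 1) : dist (ofRay (w.toRay hw)) w = 0 :=
    dist_eq_zero_of_bounded (C := 0) fun t _ => by simp [ofRay, toRay]
  rw [ip_congr (this u hu) (this v hv)]

end Tits
end LinRay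

namespace LinRay
section Simplices
variable [MetricSpace X] [CAT0Space X]

omit [CAT0Space X] in
theorem speed_scale {a : ℝ} (ha : 0 ≤ a) (u : LinRay X) : (scale a u).speed = a * u.speed := by
  change |a| * u.speed = _
  rw [abs_of_nonneg ha]

theorem continuous_speed : Continuous (speed : LinRay X → ℝ) :=
  (LipschitzWith.of_dist_le_mul (K := 1) fun u v => by
    rw [NNReal.coe_one, one_mul, Real.dist_eq]; exact dist_speed u v).continuous

theorem continuous_ip_right (p : LinRay X) : Continuous (ip p) :=
  (LipschitzWith.of_dist_le_mul (K := ⟨p.speed, p.speed_nonneg⟩) fun u v => by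
    rw [Real.dist_eq]; exact abs_ip_sub_le p u v).continuous

theorem continuous_scale_left (u : LinRay X) : Continuous fun a : ℝ => scale a u :=
  (LipschitzWith.of_dist_le_mul (K := ⟨u.speed, u.speed_nonneg⟩) fun a b => by
    rw [dist_scale_left, Real.dist_eq, mul_comm]
    exact mul_le_mul_of_nonneg_left (abs_abs_sub_abs_le_abs_sub a b) u.speed_nonneg).continuous

variable [ProperSpace X]

theorem continuous_add_apply {α : Type*} [TopologicalSpace α] {f g : α → LinRay X}
    (hf : Continuous f) (hg : Continuous g) : Continuous fun a => add (f a) (g a) := by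
  refine continuous_iff_continuousAt.2 fun a => tendsto_iff_dist_tendsto_zero.2 ?_
  have h := (tendsto_iff_dist_tendsto_zero.1 (hf.tendsto a)).add
    (tendsto_iff_dist_tendsto_zero.1 (hg.tendsto a))
  rw [add_zero] at h
  exact squeeze_zero (fun _ => dist_nonneg) (fun b => dist_add_add_le _ _ _ _) h

theorem speed_le_speed_add_right {u v : LinRay X} (h : 0 ≤ ip u v) :
    v.speed ≤ (add u v).speed := by
  have h1 := ip_add_le v u v
  have h2 := ip_le v (add u v)
  rw [ip_self, ip_comm] at h1
  rcases v.speed_nonneg.eq_or_lt with h0 | h0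
  · rw [← h0]; exact (add u v).speed_nonneg
  · refine le_of_mul_le_mul_left ?_ h0
    linarith [sq v.speed]

theorem exists_sum_ip_le [Nonempty X] {ι : Type*} (s : Finset ι) (w : ι → LinRay X) :
    ∃ v : LinRay X, ∀ p : LinRay X, ∑ i ∈ s, ip p (w i) ≤ ip p v := by
  classical
  induction s using Finset.induction_on with
  | empty =>
    obtain ⟨x⟩ := ‹Nonempty X›
    refine ⟨const x, fun p => ?_⟩
    have := neg_le_ip p (const x)
    simpa [const] using this
  | insert i s hi ih =>
    obtain ⟨v, hv⟩ := ih
    refine ⟨add (w i) v, fun p => ?_⟩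
    rw [Finset.sum_insert hi]
    linarith [ip_add_le p (w i) v, hv p]

/-- A conical simplex in the asymptotic cone whose facets have no common direction, even
approximately. -/
structure ConeSimplex (K : Set (LinRay X)) (m : ℕ) where
  toFun : (Fin (m + 1) → ℝ) → LinRay X
  continuous : Continuous toFun
  ip_nonneg : ∀ l, 0 ≤ l → ∀ p ∈ K, 0 ≤ ip p (toFun l)
  lower : ℝ
  lower_pos : 0 < lower
  le_speed : ∀ l, 0 ≤ l → lower * ∑ i, l i ≤ (toFun l).speed
  homogeneous : ∀ c : ℝ, 0 ≤ c → ∀ l, 0 ≤ l → dist (toFun (c • l)) (scale c (toFun l)) = 0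
  gap : ℝ
  gap_pos : 0 < gap
  gap_le : ∀ (v : LinRay X) (l : Fin (m + 1) → Fin (m + 1) → ℝ), (∀ i, 0 ≤ l i) →
    (∀ i, l i i = 0) → ∃ i, gap * v.speed ≤ dist v (toFun (l i))

omit [ProperSpace X] in
theorem nonempty_coneSimplex_zero {K : Set (LinRay X)} (hunit : ∀ u ∈ K, u.speed = 1)
    (hK : ∀ u ∈ K, ∀ v ∈ K, 0 ≤ ip u v) (hne : K.Nonempty) : Nonempty (ConeSimplex K 0) := by
  obtain ⟨p, hp⟩ := hne
  refine ⟨⟨fun l => scale (l 0) p, (continuous_scale_left p).comp (continuous_apply 0), ?_, 1,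
    one_pos, ?_, ?_, 1, one_pos, ?_⟩⟩
  · intro l hl q hq
    rw [ip_scale_right (hl 0)]
    exact mul_nonneg (hl 0) (hK q hq p hp)
  · intro l hl
    rw [speed_scale (hl 0), hunit p hp]
    simp
  · intro c _ l _
    rw [dist_comm]
    exact dist_scale_scale_comp c (l 0) p
  · intro v l _ h0
    refine ⟨0, ?_⟩
    rw [h0 0]
    have := abs_le.1 (dist_speed v (scale 0 p))
    rw [speed_scale le_rfl, zero_mul, sub_zero] at this
    linarith

theorem ConeSimplex.exists_ip_le {K : Set (LinRay X)}
    (hunit : ∀ u ∈ K, u.speed = 1)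
    (hsmall : ∀ v : LinRay X, ∀ ε > (0:ℝ), ∃ p ∈ K, ip p v ≤ ε) {m : ℕ} (σ : ConeSimplex K m)
    {ε : ℝ} (hε : 0 < ε) :
    ∃ p ∈ K, ∀ l, 0 ≤ l → ip p (σ.toFun l) ≤ ε * (σ.toFun l).speed := by
  set η := ε * σ.lower / 2 with hη
  have hη0 : 0 < η := by have := σ.lower_pos; positivity
  have hc : IsCompact (σ.toFun '' stdSimplex ℝ (Fin (m + 1))) :=
    (isCompact_stdSimplex ℝ _).image σ.continuous
  obtain ⟨t, hts, htf, hcov⟩ := hc.finite_cover_balls hη0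
  have : Nonempty X := ⟨σ.toFun 0 0⟩
  obtain ⟨v, hv⟩ := exists_sum_ip_le htf.toFinset id
  obtain ⟨p, hp, hpv⟩ := hsmall v η hη0
  have hnn : ∀ w ∈ t, 0 ≤ ip p w := by
    intro w hw
    obtain ⟨l, hl, rfl⟩ := hts hw
    exact σ.ip_nonneg l hl.1 p hp
  refine ⟨p, hp, fun l hl => ?_⟩
  set s := ∑ i, l i with hs
  have hs0 : 0 ≤ s := Finset.sum_nonneg fun i _ => hl i
  have h1 : ip p (σ.toFun l) ≤ 2 * η * s := by
    rcases hs0.eq_or_lt with h0 | h0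
    · have hl0 : l = (0:ℝ) • l := by
        funext i
        have := (Finset.sum_eq_zero_iff_of_nonneg fun i _ => hl i).1 h0.symm i (Finset.mem_univ i)
        simp [this]
      rw [hl0, ip_congr (dist_self p) (σ.homogeneous 0 le_rfl l hl), ip_scale_right le_rfl, ← h0]
      simp
    · have hmem : s⁻¹ • l ∈ stdSimplex ℝ (Fin (m + 1)) := by
        refine ⟨fun i => ?_, ?_⟩
        · simp only [Pi.smul_apply, smul_eq_mul]
          exact mul_nonneg (by positivity) (hl i)
        · simp only [Pi.smul_apply, smul_eq_mul, ← Finset.mul_sum, ← hs]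
          exact inv_mul_cancel₀ h0.ne'
      obtain ⟨w, hw, hlw⟩ := mem_iUnion₂.1 (hcov ⟨_, hmem, rfl⟩)
      have h2 := ip_sub_le p (σ.toFun (s⁻¹ • l)) w
      rw [hunit p hp, one_mul] at h2
      have h3 : ip p w ≤ ip p v := by
        refine le_trans ?_ (hv p)
        exact Finset.single_le_sum (f := fun w => ip p w)
          (fun w hw => hnn w (htf.mem_toFinset.1 hw)) (htf.mem_toFinset.2 hw)
      have h4 : ip p (σ.toFun l) = s * ip p (σ.toFun (s⁻¹ • l)) := by
        rw [← ip_scale_right hs0, ← ip_congr (dist_self p) (σ.homogeneous s hs0 _ hmem.1),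
          smul_smul, mul_inv_cancel₀ h0.ne', one_smul]
      rw [h4, mul_comm]
      refine mul_le_mul_of_nonneg_right ?_ hs0
      linarith [mem_ball.1 hlw]
  have h2 := mul_le_mul_of_nonneg_left (σ.le_speed l hl) hε.le
  have : 2 * η * s = ε * (σ.lower * s) := by rw [hη]; ring
  linarith

/-- The coordinates but the last. -/
def initCoord {m : ℕ} (l : Fin (m + 1 + 1) → ℝ) : Fin (m + 1) → ℝ := fun i => l i.castSucc

theorem ConeSimplex.nonempty_succ {K : Set (LinRay X)}
    (hunit : ∀ u ∈ K, u.speed = 1) (hK : ∀ u ∈ K, ∀ v ∈ K, 0 ≤ ip u v)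
    (hsmall : ∀ v : LinRay X, ∀ ε > (0:ℝ), ∃ p ∈ K, ip p v ≤ ε) {m : ℕ} (σ : ConeSimplex K m) :
    Nonempty (ConeSimplex K (m + 1)) := by
  set δ := min σ.gap 1 / 10 with hδ
  have hg := σ.gap_pos
  have hδ0 : 0 < δ := by positivity
  have hδ1 : 10 * δ ≤ σ.gap := by rw [hδ]; linarith [min_le_left σ.gap 1]
  have hδ2 : 10 * δ ≤ 1 := by rw [hδ]; linarith [min_le_right σ.gap 1]
  obtain ⟨p, hp, hpσ⟩ := σ.exists_ip_le hunit hsmall hδ0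
  have hp1 := hunit p hp
  have hinit {l : Fin (m + 1 + 1) → ℝ} (hl : 0 ≤ l) : 0 ≤ initCoord l := fun i => hl i.castSucc
  have hpos {l : Fin (m + 1 + 1) → ℝ} (hl : 0 ≤ l) :
      0 ≤ ip (σ.toFun (initCoord l)) (scale (l (Fin.last _)) p) := by
    rw [ip_scale_right (hl _), ip_comm]
    exact mul_nonneg (hl _) (σ.ip_nonneg _ (hinit hl) p hp)
  have hlow : 0 < min σ.lower 1 / 2 := half_pos (lt_min σ.lower_pos one_pos)
  refine ⟨⟨fun l => add (σ.toFun (initCoord l)) (scale (l (Fin.last _)) p), ?_, ?_,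
    min σ.lower 1 / 2, hlow, ?_, ?_, δ, hδ0, ?_⟩⟩
  · have h1 : Continuous (initCoord (m := m)) := continuous_pi fun i => continuous_apply _
    have h2 : Continuous fun l : Fin (m + 1 + 1) → ℝ => scale (l (Fin.last _)) p :=
      (continuous_scale_left p).comp (continuous_apply _)
    have h3 : Continuous fun l => σ.toFun (initCoord l) := σ.continuous.comp h1
    exact continuous_add_apply h3 h2
  · intro l hl q hq
    refine le_trans (add_nonneg (σ.ip_nonneg _ (hinit hl) q hq) ?_) (ip_add_le q _ _)
    rw [ip_scale_right (hl _)]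
    exact mul_nonneg (hl _) (hK q hq p hp)
  · intro l hl
    have h1 := speed_le_speed_add (hpos hl)
    have h2 := speed_le_speed_add_right (hpos hl)
    rw [speed_scale (hl _), hp1, mul_one] at h2
    have h3 := σ.le_speed _ (hinit hl)
    rw [Fin.sum_univ_castSucc]
    have h4 : ∑ i : Fin (m + 1), l i.castSucc = ∑ i, initCoord l i := rfl
    rw [h4]
    have h5 : 0 ≤ ∑ i, initCoord l i := Finset.sum_nonneg fun i _ => hinit hl i
    have h6 := mul_le_mul_of_nonneg_right (min_le_left σ.lower 1) h5
    have h7 := mul_le_mul_of_nonneg_right (min_le_right σ.lower 1) (hl (Fin.last _))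
    linarith
  · intro c hc l hl
    have h1 := dist_scale_add c (σ.toFun (initCoord l)) (scale (l (Fin.last _)) p)
    have h2 := dist_add_add_le (σ.toFun (initCoord (c • l))) (scale ((c • l) (Fin.last _)) p)
      (scale c (σ.toFun (initCoord l))) (scale c (scale (l (Fin.last _)) p))
    have h3 : dist (σ.toFun (initCoord (c • l))) (scale c (σ.toFun (initCoord l))) = 0 :=
      σ.homogeneous c hc _ (hinit hl)
    have h4 : dist (scale ((c • l) (Fin.last _)) p) (scale c (scale (l (Fin.last _)) p)) = 0 := by
      rw [dist_comm]; exact dist_scale_scale_comp c (l (Fin.last _)) p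
    rw [h3, h4, add_zero] at h2
    rw [dist_congr (le_antisymm h2 dist_nonneg) h1, dist_self]
  · intro v l hl h0
    by_contra hcon
    push Not at hcon
    have hr := v.speed_nonneg
    set w := fun i => σ.toFun (initCoord (l i))
    set t := fun i => l i (Fin.last _)
    have ht (i) : 0 ≤ t i := hl i _
    have hst (i) : (scale (t i) p).speed = t i := by rw [speed_scale (ht i), hp1, mul_one]
    have hvw (i) : dist v (w i) < δ * v.speed + t i := by
      have h1 := dist_add_left_le (w i) (scale (t i) p)
      rw [hst] at h1
      linarith [dist_triangle v (add (w i) (scale (t i) p)) (w i), hcon i]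
    have hlast : dist v (w (Fin.last _)) < δ * v.speed := by
      have := hvw (Fin.last _)
      have e : t (Fin.last _) = 0 := h0 _
      linarith
    have htle (i) : t i ≤ δ * ((1 + δ) * v.speed) + 2 * δ * v.speed := by
      have h1 := ip_add_le p (w i) (scale (t i) p)
      rw [ip_scale_right (ht i), ip_self, hp1] at h1
      have h2 := σ.ip_nonneg _ (hinit (hl i)) p hp
      have h3 := ip_sub_le p (add (w i) (scale (t i) p)) v
      have h4 := ip_sub_le p v (w (Fin.last _))
      rw [hp1, one_mul] at h3 h4
      rw [dist_comm] at h3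
      have h5 := hpσ _ (hinit (hl (Fin.last _)))
      have h6 := (abs_le.1 (dist_speed v (w (Fin.last _)))).1
      have h7 : δ * (w (Fin.last _)).speed ≤ δ * ((1 + δ) * v.speed) :=
        mul_le_mul_of_nonneg_left (by linarith) hδ0.le
      linarith [hcon i]
    obtain ⟨j, hj⟩ := σ.gap_le v (fun j => initCoord (l j.castSucc)) (fun j => hinit (hl _))
      (fun j => h0 _)
    have h1 := hvw j.castSucc
    have h2 := htle j.castSucc
    have h3 : dist v (w j.castSucc) < σ.gap * v.speed := by
      nlinarith [mul_nonneg hδ0.le hr, mul_le_mul_of_nonneg_right hδ1 hr,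
        mul_le_mul_of_nonneg_right hδ2 (mul_nonneg hδ0.le hr)]
    exact absurd hj (not_le.2 h3)

theorem nonempty_coneSimplex {K : Set (LinRay X)} (hne : K.Nonempty)
    (hunit : ∀ u ∈ K, u.speed = 1) (hK : ∀ u ∈ K, ∀ v ∈ K, 0 ≤ ip u v)
    (hsmall : ∀ v : LinRay X, ∀ ε > (0:ℝ), ∃ p ∈ K, ip p v ≤ ε) (m : ℕ) :
    Nonempty (ConeSimplex K m) := by
  induction m with
  | zero => exact nonempty_coneSimplex_zero hunit hK hne
  | succ m ih =>
    obtain ⟨σ⟩ := ih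
    exact σ.nonempty_succ hunit hK hsmall

end Simplices
end LinRay

namespace KKM

section Chains
variable {α : Type*}

/-- The sum modulo two of `φ` over the faces of an ordered simplex. -/
def bd : List α → (List α → ZMod 2) → ZMod 2
  | [], _ => 0
  | a :: l, φ => φ l + bd l (fun t => φ (a :: t))

theorem bd_add (l : List α) (φ ψ : List α → ZMod 2) :
    bd l (fun t => φ t + ψ t) = bd l φ + bd l ψ := by
  induction l generalizing φ ψ with
  | nil => simp [bd]
  | cons a l ih => simp only [bd, ih]; ring

/-- `f` is a codimension one face of the ordered simplex `s`. -/
inductive IsFace : List α → List α → Prop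
  | tail (a : α) (l : List α) : IsFace l (a :: l)
  | cons (a : α) {f l : List α} : IsFace f l → IsFace (a :: f) (a :: l)

theorem IsFace.length_eq {f l : List α} (h : IsFace f l) : f.length + 1 = l.length := by
  induction h with
  | tail a l => rfl
  | cons a _ ih => simp [ih]

theorem IsFace.subset {f l : List α} (h : IsFace f l) : f ⊆ l := by
  induction h with
  | tail a l => exact List.subset_cons_self a l
  | cons a _ ih => exact List.cons_subset_cons a ih

theorem bd_congr {l : List α} {φ ψ : List α → ZMod 2} (h : ∀ f, IsFace f l → φ f = ψ f) :
    bd l φ = bd l ψ := by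
  induction l generalizing φ ψ with
  | nil => rfl
  | cons a l ih => simp only [bd, h l (.tail a l), ih fun f hf => h _ (.cons a hf)]

theorem bd_zero (l : List α) : bd l (fun _ => 0) = 0 := by
  induction l with
  | nil => rfl
  | cons a l ih => simp only [bd, ih, add_zero]

theorem bd_bd (l : List α) (φ : List α → ZMod 2) : bd l (fun f => bd f φ) = 0 := by
  induction l generalizing φ with
  | nil => rfl
  | cons a l ih =>
    simp only [bd, bd_add, ih, add_zero]
    exact CharTwo.add_self_eq_zero _

theorem bd_perm {l l' : List α} (h : l.Perm l') (φ : List α → ZMod 2)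
    (hφ : ∀ t t' : List α, t.Perm t' → φ t = φ t') : bd l φ = bd l' φ := by
  induction h generalizing φ with
  | nil => rfl
  | cons a h ih =>
    simp only [bd, hφ _ _ h, ih _ fun t t' ht => hφ _ _ (ht.cons a)]
  | swap a b l =>
    simp only [bd]
    rw [bd_congr fun f _ => hφ _ _ (List.Perm.swap a b f)]
    ring
  | trans _ _ ih1 ih2 => rw [ih1 φ hφ, ih2 φ hφ]

end Chains

section Labels

/-- The indicator of label lists containing every label below `k`. -/
def full (k : ℕ) (L : List ℕ) : ZMod 2 := if Finset.range k ⊆ L.toFinset then 1 else 0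

theorem full_eq_zero {k : ℕ} {L : List ℕ} (h : L.toFinset.card < k) : full k L = 0 := by
  rw [full, if_neg]
  intro hs
  have := Finset.card_le_card hs
  rw [Finset.card_range] at this
  omega

theorem full_eq_zero_of_notMem {k j : ℕ} {L : List ℕ} (hj : j < k) (h : j ∉ L) :
    full k L = 0 := by
  rw [full, if_neg]
  intro hs
  exact h (List.mem_toFinset.1 (hs (Finset.mem_range.2 hj)))

theorem full_perm (k : ℕ) (t t' : List ℕ) (h : t.Perm t') : full k t = full k t' := by
  simp only [full, List.toFinset_eq_of_perm _ _ h]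

theorem full_succ_eq_bd {k : ℕ} {L : List ℕ} (hlen : L.length = k + 1) (hle : ∀ i ∈ L, i ≤ k) :
    full (k + 1) L = bd L (full k) := by
  by_cases hnd : L.Nodup
  · have hperm : L.Perm (k :: List.range k) := by
      have hp : L.Perm (List.range (k + 1)) := by
        refine (List.subperm_of_subset hnd fun i hi => ?_).perm_of_length_le (by simp [hlen])
        exact List.mem_range.2 (Nat.lt_succ_of_le (hle i hi))
      refine hp.trans ?_
      rw [List.range_succ]
      exact List.perm_append_singleton _ _
    rw [full_perm _ _ _ hperm, bd_perm hperm _ (full_perm k)]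
    have h0 : bd (List.range k) (fun t => full k (k :: t)) = 0 := by
      rw [← bd_zero (List.range k)]
      refine bd_congr fun f hf => ?_
      have hl := hf.length_eq
      rw [List.length_range] at hl
      rw [full, if_neg]
      intro hs
      have : Finset.range k ⊆ f.toFinset := by
        intro i hi
        have h1 := hs hi
        have h2 := Finset.mem_range.1 hi
        rw [List.mem_toFinset, List.mem_cons] at h1
        rw [List.mem_toFinset]
        exact h1.resolve_left (by omega)
      have h1 := (Finset.card_le_card this).trans f.toFinset_card_le
      rw [Finset.card_range] at h1
      omega
    simp only [bd, h0, add_zero]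
    rw [full, full, if_pos, if_pos]
    · intro i hi; simpa using hi
    · intro i hi
      rw [Finset.mem_range] at hi
      rw [List.mem_toFinset, List.mem_cons, List.mem_range]
      omega
  · obtain ⟨a, ha⟩ : ∃ a, List.Sublist [a, a] L := by
      by_contra hcon
      push Not at hcon
      exact hnd (List.nodup_iff_sublist.2 hcon)
    obtain ⟨r, hr⟩ : ∃ r, L.Perm (a :: a :: r) := by
      obtain ⟨r, hr⟩ := ha.exists_perm_append
      exact ⟨r, hr⟩
    have hl := hr.length_eq
    simp only [List.length_cons, hlen] at hl
    have hcard (t : List ℕ) : (a :: a :: t).toFinset.card ≤ t.length + 1 := by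
      have : (a :: a :: t).toFinset = (a :: t).toFinset := by simp
      rw [this]
      exact List.toFinset_card_le _
    rw [full_perm _ _ _ hr, bd_perm hr _ (full_perm k),
      full_eq_zero ((hcard r).trans_lt (by omega))]
    have h0 : bd r (fun t => full k (a :: a :: t)) = 0 := by
      rw [← bd_zero r]
      refine bd_congr fun f hf => full_eq_zero ((hcard f).trans_lt ?_)
      have := hf.length_eq
      omega
    simp only [bd, h0, add_zero]
    exact (CharTwo.add_self_eq_zero _).symm

end Labels

section Subdivision
variable {E : Type*} [NormedAddCommGroup E] [NormedSpace ℝ E]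

/-- The barycentre of the vertices of a simplex. -/
noncomputable def bary (s : List E) : E := ∑ i : Fin s.length, (s.length : ℝ)⁻¹ • s[i]

theorem bary_mem {A : Set E} (hA : Convex ℝ A) {s : List E} (hs : s ≠ []) (h : ∀ x ∈ s, x ∈ A) :
    bary s ∈ A := by
  have hl : (s.length : ℝ) ≠ 0 := by
    simpa using hs
  refine hA.sum_mem (fun i _ => by positivity) ?_ fun i _ => h _ (List.getElem_mem _)
  rw [Finset.sum_const, Finset.card_univ, Fintype.card_fin, nsmul_eq_mul]
  exact mul_inv_cancel₀ hl

theorem dist_bary_le {m : ℕ} {s : List E} (hm : s.length ≤ m + 1) {d : ℝ}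
    (hd : ∀ x ∈ s, ∀ y ∈ s, dist x y ≤ d) {x : E} (hx : x ∈ s) :
    dist x (bary s) ≤ m / (m + 1) * d := by
  obtain ⟨i, hi, rfl⟩ := List.getElem_of_mem hx
  set n := s.length with hn
  have hd0 : 0 ≤ d := dist_nonneg.trans (hd _ hx _ hx)
  have hn0 : (0:ℝ) < n := by exact_mod_cast (Nat.zero_le i).trans_lt hi
  have e : bary s - s[i] = ∑ j : Fin n, (n : ℝ)⁻¹ • (s[j] - s[i]) := by
    simp only [smul_sub, Finset.sum_sub_distrib, Finset.sum_const, Finset.card_univ,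
      Fintype.card_fin]
    rw [← Nat.cast_smul_eq_nsmul ℝ, smul_smul, mul_inv_cancel₀ hn0.ne', one_smul]
    rfl
  rw [dist_comm, dist_eq_norm, e]
  have h1 : ∀ j : Fin n, ‖(n : ℝ)⁻¹ • (s[j] - s[i])‖ ≤ if j = ⟨i, hi⟩ then 0 else (n:ℝ)⁻¹ * d := by
    intro j
    split_ifs with hj
    · subst hj; simp
    · rw [norm_smul, ← dist_eq_norm, Real.norm_of_nonneg (by positivity)]
      exact mul_le_mul_of_nonneg_left (hd _ (List.getElem_mem _) _ (List.getElem_mem _))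
        (by positivity)
  refine (norm_sum_le_of_le _ fun j _ => h1 j).trans ?_
  have h2 : ∑ j : Fin n, (if j = ⟨i, hi⟩ then 0 else (n:ℝ)⁻¹ * d) = (n - 1) / n * d := by
    have : ∀ j : Fin n, (if j = ⟨i, hi⟩ then 0 else (n:ℝ)⁻¹ * d) =
        (n:ℝ)⁻¹ * d - if j = ⟨i, hi⟩ then (n:ℝ)⁻¹ * d else 0 := by
      intro j; split_ifs <;> ring
    simp only [this, Finset.sum_sub_distrib, Finset.sum_const, Finset.card_univ, Fintype.card_fin,
      Finset.sum_ite_eq', Finset.mem_univ, if_true, nsmul_eq_mul]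
    field_simp
  rw [h2]
  refine mul_le_mul_of_nonneg_right ?_ hd0
  rw [div_le_div_iff₀ hn0 (by positivity)]
  have : (n:ℝ) ≤ m + 1 := by exact_mod_cast hm
  linarith

/-- The sum modulo two of `φ` over the barycentric subdivision of an ordered simplex with `n`
vertices. -/
noncomputable def sd : ℕ → (List E → ZMod 2) → List E → ZMod 2
  | 0, φ, _ => φ []
  | n + 1, φ, s => bd s (sd n fun t => φ (bary s :: t))

theorem sd_add (n : ℕ) (φ ψ : List E → ZMod 2) (s : List E) :
    sd n (fun t => φ t + ψ t) s = sd n φ s + sd n ψ s := by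
  induction n generalizing φ ψ s with
  | zero => rfl
  | succ n ih =>
    simp only [sd]
    rw [← bd_add]
    exact bd_congr fun f _ => ih _ _ f

theorem sd_zero (n : ℕ) (s : List E) : sd n (fun _ => 0) s = 0 := by
  induction n generalizing s with
  | zero => rfl
  | succ n ih =>
    exact (bd_congr fun f _ => ih f).trans (bd_zero s)

theorem sd_bd {n : ℕ} (φ : List E → ZMod 2) {s : List E} (hs : s.length = n + 1) :
    sd (n + 1) (fun t => bd t φ) s = bd s (sd n φ) := by
  induction n generalizing φ s with
  | zero =>
    simp only [sd, bd, add_zero]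
  | succ n ih =>
    change bd s (sd (n + 1) fun t => φ t + bd t fun t => φ (bary s :: t)) = _
    rw [bd_congr fun f _ => sd_add (n + 1) φ (fun t => bd t fun t => φ (bary s :: t)) f, bd_add,
      bd_congr (φ := sd (n + 1) fun t => bd t fun t => φ (bary s :: t)) fun f hf =>
        ih (fun t => φ (bary s :: t)) (s := f) (by have := hf.length_eq; omega), bd_bd, add_zero]

theorem sd_congr {m n : ℕ} (hn : n ≤ m + 1) {A : Set E} (hA : Convex ℝ A) {d : ℝ}
    {φ ψ : List E → ZMod 2} {s : List E} (hs : s.length = n) (hsA : ∀ x ∈ s, x ∈ A)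
    (hd : ∀ x ∈ s, ∀ y ∈ s, dist x y ≤ d)
    (h : ∀ t : List E, t.length = n → (∀ x ∈ t, x ∈ A) →
      (∀ x ∈ t, ∀ y ∈ t, dist x y ≤ m / (m + 1) * d) → φ t = ψ t) :
    sd n φ s = sd n ψ s := by
  induction n generalizing φ ψ s A with
  | zero => exact h [] rfl (by simp) (by simp)
  | succ n ih =>
    simp only [sd]
    have hne : s ≠ [] := by rintro rfl; simp at hs
    have hb := fun x hx => dist_bary_le (hs.trans_le hn) hd (x := x) hx
    obtain ⟨x₀, hx₀⟩ := List.exists_mem_of_ne_nil s hne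
    have hd0 : 0 ≤ m / (m + 1) * d := dist_nonneg.trans (hb x₀ hx₀)
    refine bd_congr fun f hf => ?_
    refine ih (A := A ∩ closedBall (bary s) (m / (m + 1) * d)) (by omega)
      (hA.inter (convex_closedBall _ _)) (by have := hf.length_eq; omega)
      (fun x hx => ⟨hsA x (hf.subset hx), hb x (hf.subset hx)⟩)
      (fun x hx y hy => hd x (hf.subset hx) y (hf.subset hy)) fun t ht htA htd => ?_
    refine h _ (by simp [ht]) ?_ ?_
    · intro x hx
      rcases List.mem_cons.1 hx with rfl | hx
      · exact bary_mem hA hne hsA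
      · exact (htA x hx).1
    · intro x hx y hy
      rcases List.mem_cons.1 hx with rfl | hx <;> rcases List.mem_cons.1 hy with rfl | hy
      · rwa [dist_self]
      · rw [dist_comm]; exact (htA y hy).2
      · exact (htA x hx).2
      · exact htd x hx y hy

theorem iterate_sd_congr {m n : ℕ} (hn : n ≤ m + 1) {A : Set E} (hA : Convex ℝ A) (N : ℕ) {d : ℝ}
    {φ ψ : List E → ZMod 2} {s : List E} (hs : s.length = n) (hsA : ∀ x ∈ s, x ∈ A)
    (hd : ∀ x ∈ s, ∀ y ∈ s, dist x y ≤ d)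
    (h : ∀ t : List E, t.length = n → (∀ x ∈ t, x ∈ A) →
      (∀ x ∈ t, ∀ y ∈ t, dist x y ≤ (m / (m + 1)) ^ N * d) → φ t = ψ t) :
    (sd n)^[N] φ s = (sd n)^[N] ψ s := by
  induction N generalizing d s with
  | zero => exact h s hs hsA (by simpa using hd)
  | succ N ih =>
    rw [Function.iterate_succ_apply', Function.iterate_succ_apply']
    refine sd_congr hn hA hs hsA hd fun t ht htA htd => ih ht htA htd fun r hr hrA hrd => ?_
    refine h r hr hrA fun x hx y hy => (hrd x hx y hy).trans (le_of_eq ?_)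
    rw [pow_succ]; ring

theorem iterate_sd_zero (n N : ℕ) (s : List E) : (sd n)^[N] (fun _ => 0) s = 0 := by
  have : (sd n)^[N] (fun _ => 0) = fun _ : List E => 0 :=
    Function.iterate_fixed (funext (sd_zero n)) N
  rw [this]

theorem iterate_sd_bd {n : ℕ} (N : ℕ) (φ : List E → ZMod 2) {s : List E} (hs : s.length = n + 1) :
    (sd (n + 1))^[N] (fun t => bd t φ) s = bd s ((sd n)^[N] φ) := by
  induction N generalizing s with
  | zero => rfl
  | succ N ih =>
    rw [Function.iterate_succ_apply', Function.iterate_succ_apply', ← sd_bd _ hs]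
    obtain ⟨d, hd⟩ : ∃ d : ℝ, ∀ x ∈ s, ∀ y ∈ s, dist x y ≤ d := by
      classical
      obtain ⟨d, hd⟩ := isBounded_iff.1 s.toFinset.finite_toSet.isBounded
      exact ⟨d, fun x hx y hy => hd (by simpa using hx) (by simpa using hy)⟩
    exact sd_congr (m := n) le_rfl convex_univ hs (fun _ _ => mem_univ _) hd
      fun t ht _ _ => ih ht

end Subdivision
end KKM

namespace KKM

section Simplex

/-- The `i`-th vertex of the standard simplex. -/
def vert (m i : ℕ) : Fin (m + 1) → ℝ := fun j => if (j : ℕ) = i then 1 else 0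

/-- The list of the first `k` vertices of the standard simplex. -/
def verts (m : ℕ) : ℕ → List (Fin (m + 1) → ℝ)
  | 0 => []
  | k + 1 => vert m k :: verts m k

theorem length_verts (m k : ℕ) : (verts m k).length = k := by
  induction k with
  | zero => rfl
  | succ k ih => simp [verts, ih]

theorem mem_verts {m k : ℕ} {x : Fin (m + 1) → ℝ} (hx : x ∈ verts m k) :
    ∃ i < k, x = vert m i := by
  induction k with
  | zero => simp [verts] at hx
  | succ k ih =>
    rcases List.mem_cons.1 hx with rfl | hx
    · exact ⟨k, k.lt_succ_self, rfl⟩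
    · obtain ⟨i, hi, rfl⟩ := ih hx
      exact ⟨i, by omega, rfl⟩

theorem exists_coord_eq_zero {m k : ℕ} {f : List (Fin (m + 1) → ℝ)} (hf : IsFace f (verts m k)) :
    ∃ j < k, ∀ x ∈ f, ∀ i : Fin (m + 1), (i : ℕ) = j → x i = 0 := by
  induction k generalizing f with
  | zero => cases hf
  | succ k ih =>
    cases hf with
    | tail =>
      refine ⟨k, k.lt_succ_self, fun x hx i hi => ?_⟩
      obtain ⟨j, hj, rfl⟩ := mem_verts hx
      rw [vert, if_neg]
      omega
    | cons _ hf =>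
      obtain ⟨j, hj, h⟩ := ih hf
      refine ⟨j, by omega, fun x hx i hi => ?_⟩
      rcases List.mem_cons.1 hx with rfl | hx
      · rw [vert, if_neg]
        omega
      · exact h x hx i hi

theorem vert_mem {m i : ℕ} (hi : i < m + 1) : vert m i ∈ stdSimplex ℝ (Fin (m + 1)) := by
  refine ⟨fun j => by unfold vert; split_ifs <;> norm_num, ?_⟩
  rw [Finset.sum_eq_single ⟨i, hi⟩]
  · simp [vert]
  · intro j _ hj
    rw [vert, if_neg]
    exact fun h => hj (Fin.ext h)
  · simp

theorem dist_le_one {m : ℕ} {x y : Fin (m + 1) → ℝ} (hx : x ∈ stdSimplex ℝ (Fin (m + 1)))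
    (hy : y ∈ stdSimplex ℝ (Fin (m + 1))) : dist x y ≤ 1 := by
  refine (dist_pi_le_iff zero_le_one).2 fun i => ?_
  have hle {z : Fin (m + 1) → ℝ} (hz : z ∈ stdSimplex ℝ (Fin (m + 1))) : z i ≤ 1 := by
    rw [← hz.2]
    exact Finset.single_le_sum (fun j _ => hz.1 j) (Finset.mem_univ i)
  rw [Real.dist_eq, abs_le]
  constructor <;> linarith [hx.1 i, hy.1 i, hle hx, hle hy]

theorem convex_coord {m : ℕ} (P : Fin (m + 1) → Prop) :
    Convex ℝ {x | x ∈ stdSimplex ℝ (Fin (m + 1)) ∧ ∀ i, P i → x i = 0} := by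
  intro x hx y hy a b ha hb hab
  refine ⟨convex_stdSimplex ℝ _ hx.1 hy.1 ha hb hab, fun i hi => ?_⟩
  simp [hx.2 i hi, hy.2 i hi]

theorem bd_map {α β : Type*} (g : α → β) (t : List α) (φ : List β → ZMod 2) :
    bd (t.map g) φ = bd t fun r => φ (r.map g) := by
  induction t generalizing φ with
  | nil => rfl
  | cons a t ih => simp only [List.map_cons, bd, ih]

theorem verts_mem {m k : ℕ} (hk : k ≤ m + 1) {x : Fin (m + 1) → ℝ} (hx : x ∈ verts m k) :
    x ∈ stdSimplex ℝ (Fin (m + 1)) := by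
  obtain ⟨i, hi, rfl⟩ := mem_verts hx
  exact vert_mem (by omega)

theorem iterate_sd_full {m : ℕ} {ℓ : (Fin (m + 1) → ℝ) → ℕ}
    (hℓ : ∀ x ∈ stdSimplex ℝ (Fin (m + 1)), ∃ i : Fin (m + 1), ℓ x = i ∧ x i ≠ 0) (N : ℕ) {k : ℕ}
    (hk : k ≤ m + 1) : (sd k)^[N] (fun t => full k (t.map ℓ)) (verts m k) = 1 := by
  induction k with
  | zero =>
    induction N with
    | zero => simp [verts, full]
    | succ N ih =>
      rw [Function.iterate_succ_apply']
      exact ih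
  | succ k ih =>
    have hl := length_verts m
    rw [iterate_sd_congr (m := m) hk (convex_coord fun i => k + 1 ≤ (i : ℕ)) N (d := 1)
      (ψ := fun t => bd t fun r => full k (r.map ℓ)) (hl _)
      (fun x hx => ⟨verts_mem hk hx, fun i hi => ?_⟩)
      (fun x hx y hy => dist_le_one (verts_mem hk hx) (verts_mem hk hy))
      (fun t ht htA _ => ?_), iterate_sd_bd N _ (hl _)]
    · simp only [verts, bd]
      rw [ih (by omega), bd_congr (ψ := fun _ => 0), bd_zero, add_zero]
      intro f hf
      have hf' : IsFace (vert m k :: f) (verts m (k + 1)) := .cons _ hf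
      obtain ⟨j, hj, h⟩ := exists_coord_eq_zero hf'
      have hj' : j < k := by
        refine lt_of_le_of_ne (by omega) ?_
        rintro rfl
        have := h _ List.mem_cons_self ⟨j, by omega⟩ rfl
        simp [vert] at this
      have hsub : ∀ x ∈ vert m k :: f, x ∈ stdSimplex ℝ (Fin (m + 1)) := by
        intro x hx
        refine verts_mem hk (List.cons_subset_cons _ hf.subset hx)
      rw [iterate_sd_congr (m := m) (by omega) (convex_coord fun i => (i : ℕ) = j) N (d := 1)
        (ψ := fun _ => 0) (by rw [List.length_cons, hf.length_eq, hl])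
        (fun x hx => ⟨hsub x hx, fun i hi => h x hx i hi⟩)
        (fun x hx y hy => dist_le_one (hsub x hx) (hsub y hy)) fun t ht htA _ => ?_,
        iterate_sd_zero]
      refine full_eq_zero_of_notMem hj' fun hmem => ?_
      obtain ⟨x, hx, hxj⟩ := List.mem_map.1 hmem
      obtain ⟨i, hi, hne⟩ := hℓ x (htA x hx).1
      exact hne ((htA x hx).2 i (by omega))
    · obtain ⟨j, hj, rfl⟩ := mem_verts hx
      rw [vert, if_neg]
      omega
    · rw [← bd_map]
      refine full_succ_eq_bd (by rw [List.length_map, ht]) fun l hmem => ?_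
      obtain ⟨x, hx, rfl⟩ := List.mem_map.1 hmem
      obtain ⟨i, hi, hne⟩ := hℓ x (htA x hx).1
      by_contra hcon
      exact hne ((htA x hx).2 i (by omega))

theorem exists_mem_forall {m : ℕ} (U : Fin (m + 1) → Set (stdSimplex ℝ (Fin (m + 1))))
    (hU : ∀ i, IsOpen (U i)) (hcov : ∀ x, ∃ i, x ∈ U i) (hne : ∀ i, ∀ x ∈ U i, x.1 i ≠ 0) :
    ∃ x, ∀ i, x ∈ U i := by
  by_contra hcon
  push Not at hcon
  obtain ⟨δ, hδ, hball⟩ := lebesgue_number_lemma_of_metric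
    (isCompact_univ (X := stdSimplex ℝ (Fin (m + 1)))) hU fun x _ => mem_iUnion.2 (hcov x)
  choose! lab hlab using fun x => hball x (mem_univ x)
  classical
  set ℓ : (Fin (m + 1) → ℝ) → ℕ := fun x => if h : x ∈ stdSimplex ℝ (Fin (m + 1)) then
    lab ⟨x, h⟩ else 0 with hℓ
  obtain ⟨N, hN⟩ := exists_pow_lt_of_lt_one hδ
    (show (m / (m + 1) : ℝ) < 1 by rw [div_lt_one (by positivity)]; linarith)
  have h1 := iterate_sd_full (ℓ := ℓ) (fun x hx => ⟨lab ⟨x, hx⟩, by simp [hℓ, hx],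
    hne _ _ (hlab ⟨x, hx⟩ (mem_ball_self hδ))⟩) N (le_refl (m + 1))
  rw [iterate_sd_congr (m := m) le_rfl (convex_stdSimplex ℝ _) N (d := 1)
        (ψ := fun _ => 0) (length_verts _ _) (fun x hx => verts_mem le_rfl hx)
        (fun x hx y hy => dist_le_one (verts_mem le_rfl hx) (verts_mem le_rfl hy))
        fun t ht htA htd => ?_, iterate_sd_zero] at h1
  · exact zero_ne_one h1
  · rw [full, if_neg]
    intro hsub
    obtain ⟨x, hx⟩ : ∃ x, x ∈ t := List.exists_mem_of_ne_nil t (by rintro rfl; simp at ht)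
    obtain ⟨i, hi⟩ := hcon ⟨x, htA x hx⟩
    have := hsub (Finset.mem_range.2 i.2)
    obtain ⟨y, hy, hyi⟩ := List.mem_map.1 (List.mem_toFinset.1 this)
    have hyi' : lab ⟨y, htA y hy⟩ = i := by
      have h2 : ((lab ⟨y, htA y hy⟩ : Fin (m + 1)) : ℕ) = i := by
        rw [← hyi]; simp [hℓ, htA y hy]
      exact Fin.ext h2
    refine hi (hyi' ▸ hlab ⟨y, htA y hy⟩ ?_)
    rw [mem_ball, Subtype.dist_eq]
    have := htd x hx y hy
    rw [mul_one] at this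
    exact this.trans_lt hN

end Simplex
end KKM

namespace LinRay
section Dimension
variable [MetricSpace X] [CAT0Space X] [ProperSpace X]

omit [CAT0Space X] [ProperSpace X] in
theorem speed_normalize {u : LinRay X} (hu : 0 < u.speed) : (scale u.speed⁻¹ u).speed = 1 := by
  rw [speed_scale (inv_nonneg.2 hu.le), inv_mul_cancel₀ hu.ne']

/-- The boundary point determined by a ray of positive speed. -/
noncomputable def dir (u : LinRay X) (hu : 0 < u.speed) : Boundary X :=
  ((scale u.speed⁻¹ u).toRay (speed_normalize hu)).cls

theorem titsAngle_dir {u v : LinRay X} (hu : 0 < u.speed) (hv : 0 < v.speed) :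
    titsAngle (dir u hu) (dir v hv) =
      Real.arccos (ip (scale u.speed⁻¹ u) (scale v.speed⁻¹ v)) :=
  titsAngle_toRay _ _

theorem continuous_dir {α : Type*} [TopologicalSpace α] {g : α → LinRay X} (hg : Continuous g)
    (hpos : ∀ a, 0 < (g a).speed) : Continuous fun a => dir (g a) (hpos a) := by
  refine continuous_generateFrom_iff.2 ?_
  rintro U ⟨ξ, r, rfl⟩
  obtain ⟨ρ, rfl⟩ := Quotient.exists_rep ξ
  have h (a : α) : titsAngle (Quotient.mk _ ρ) (dir (g a) (hpos a)) =
      Real.arccos ((g a).speed⁻¹ * ip (ofRay ρ) (g a)) := by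
    rw [← ip_scale_right (inv_nonneg.2 (hpos a).le)]
    exact titsAngle_toRay (u := ofRay ρ) rfl (speed_normalize (hpos a))
  change IsOpen {a | titsAngle _ (dir (g a) (hpos a)) < r}
  simp only [h]
  refine isOpen_lt (Real.continuous_arccos.comp (.mul ?_ ((continuous_ip_right _).comp hg)))
    continuous_const
  exact (continuous_speed.comp hg).inv₀ fun a => (hpos a).ne'

omit [ProperSpace X] in
theorem dist_le_arccos_ip {u v : LinRay X} (hu : u.speed = 1) (hv : v.speed = 1) :
    dist u v ≤ Real.arccos (ip u v) := by
  refine le_of_sq_le_sq ?_ (Real.arccos_nonneg _)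
  have h1 := ip_le u v
  have h2 := neg_le_ip u v
  have h3 := dist_sq_eq u v
  rw [hu, hv] at h1 h2 h3
  have h4 := Real.one_sub_sq_div_two_le_cos (x := Real.arccos (ip u v))
  rw [Real.cos_arccos (by linarith) (by linarith)] at h4
  linarith

theorem exists_uniform_pos (hfd : FiniteDimTitsBoundary X) {K : Set (LinRay X)} (hne : K.Nonempty)
    (hunit : ∀ u ∈ K, u.speed = 1) (hK : ∀ u ∈ K, ∀ v ∈ K, 0 ≤ ip u v) :
    ∃ v : LinRay X, ∀ u ∈ K, 1 ≤ ip u v := by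
  by_contra hcon
  push Not at hcon
  have hsmall (v : LinRay X) (ε : ℝ) (hε : 0 < ε) : ∃ p ∈ K, ip p v ≤ ε := by
    obtain ⟨p, hp, h⟩ := hcon (scale ε⁻¹ v)
    rw [ip_scale_right (inv_nonneg.2 hε.le), inv_mul_lt_iff₀ hε, mul_one] at h
    exact ⟨p, hp, h.le⟩
  obtain ⟨n, hn⟩ := hfd
  obtain ⟨σ⟩ := nonempty_coneSimplex hne hunit hK hsmall (n + 1)
  have hpos (l : stdSimplex ℝ (Fin (n + 1 + 1))) : 0 < (σ.toFun l.1).speed := by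
    have := σ.le_speed l.1 l.2.1
    rw [l.2.2, mul_one] at this
    exact σ.lower_pos.trans_le this
  set f : stdSimplex ℝ (Fin (n + 1 + 1)) → Boundary X := fun l => dir (σ.toFun l.1) (hpos l)
    with hf
  have hfc : Continuous f := continuous_dir (σ.continuous.comp continuous_subtype_val) hpos
  obtain ⟨𝒱, hVo, hVc, hVr, hVm⟩ := hn (range f) (isCompact_range hfc)
    {U | ∃ l, U = {η | titsAngle (f l) η < σ.gap}}
    (by rintro _ ⟨l, rfl⟩; exact TopologicalSpace.isOpen_generateFrom_of_mem ⟨_, _, rfl⟩)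
    (by
      rintro _ ⟨l, rfl⟩
      refine ⟨_, ⟨l, rfl⟩, ?_⟩
      rw [mem_ofPred_eq, hf, titsAngle_dir, ip_self, speed_normalize (hpos l), one_pow,
        Real.arccos_one]
      exact σ.gap_pos)
  have hidx : ∀ V ∈ 𝒱, ∃ i, ∀ l, f l ∈ V → l.1 i ≠ 0 := by
    intro V hV
    obtain ⟨_, ⟨w, rfl⟩, hVw⟩ := hVr V hV
    by_contra hno
    push Not at hno
    choose l hlV hl0 using hno
    set s : Fin (n + 1 + 1) → ℝ := fun i => (σ.toFun (l i).1).speed⁻¹ with hs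
    have hs0 (i : Fin (n + 1 + 1)) : 0 ≤ s i := inv_nonneg.2 (hpos _).le
    obtain ⟨i, hi⟩ := σ.gap_le (scale (σ.toFun w.1).speed⁻¹ (σ.toFun w.1))
      (fun i => s i • (l i).1) (fun i => smul_nonneg (hs0 i) (l i).2.1)
      (fun i => by rw [Pi.smul_apply, hl0, smul_zero])
    rw [speed_normalize (hpos w), mul_one, dist_congr (dist_self _)
      (σ.homogeneous (s i) (hs0 i) (l i).1 (l i).2.1)] at hi
    have h1 := hVw (hlV i)
    rw [mem_ofPred_eq, hf, titsAngle_dir] at h1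
    exact absurd (hi.trans (dist_le_arccos_ip (speed_normalize (hpos w))
      (speed_normalize (hpos (l i))))) (not_le.2 h1)
  choose! idx hidx using hidx
  obtain ⟨l, hl⟩ := KKM.exists_mem_forall (fun i => ⋃ V ∈ {V | V ∈ 𝒱 ∧ idx V = i}, f ⁻¹' V)
    (fun i => isOpen_biUnion fun V hV => (hVo V hV.1).preimage hfc)
    (fun x => by
      obtain ⟨V, hV, hx⟩ := hVc (mem_range_self x)
      exact ⟨idx V, mem_biUnion (x := V) ⟨hV, rfl⟩ hx⟩)
    (fun i x hx => by
      obtain ⟨V, ⟨hV, rfl⟩, hxV⟩ := mem_iUnion₂.1 hx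
      exact hidx V hV x hxV)
  have hl' (i : Fin (n + 1 + 1)) : ∃ V, (V ∈ 𝒱 ∧ f l ∈ V) ∧ idx V = i := by
    obtain ⟨V, ⟨hV, h⟩, hxV⟩ := mem_iUnion₂.1 (hl i)
    exact ⟨V, ⟨hV, hxV⟩, h⟩
  choose W hW hWi using hl'
  obtain ⟨hfin, hcard⟩ := hVm (f l) (mem_range_self l)
  have hinj : Function.Injective W := fun i j h => by rw [← hWi i, h, hWi]
  have h1 := ncard_le_ncard (range_subset_iff.2 hW) hfin
  rw [← image_univ, ncard_image_of_injective _ hinj, ncard_univ, Nat.card_fin] at h1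
  omega

end Dimension
end LinRay

namespace LinRay
section FixedPoint
variable [MetricSpace X]

theorem map_inv_map (g : X ≃ᵢ X) (u : LinRay X) : map g⁻¹ (map g u) = u := by
  cases u
  simp [map]

variable [CAT0Space X]

theorem ip_map_right (g : X ≃ᵢ X) (u v : LinRay X) : ip u (map g v) = ip (map g⁻¹ u) v := by
  rw [← ip_map_map g⁻¹, map_inv_map]

variable [ProperSpace X]

theorem exists_ip_neg (hfd : FiniteDimTitsBoundary X) (Γ : Subgroup (X ≃ᵢ X))
    (hnofix : ¬ ∃ ξ : Boundary X, ∀ g ∈ Γ, Boundary.map (⇑g) g.isometry ξ = ξ)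
    {S : Set (LinRay X)} (hunit : ∀ u ∈ S, u.speed = 1) (hinv : ∀ g ∈ Γ, ∀ u ∈ S, map g u ∈ S)
    {u : LinRay X} (hu : u ∈ S) : ∃ v ∈ S, ip u v < 0 := by
  by_contra hcon
  push Not at hcon
  set K : Set (LinRay X) := {u | u ∈ S ∧ ∀ v ∈ S, 0 ≤ ip u v} with hK
  have hKu : u ∈ K := ⟨hu, hcon⟩
  have hKinv : ∀ g ∈ Γ, ∀ p ∈ K, map g p ∈ K := by
    intro g hg p hp
    refine ⟨hinv g hg p hp.1, fun v hv => ?_⟩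
    rw [ip_comm, ip_map_right, ip_comm]
    exact hp.2 _ (hinv _ (inv_mem hg) v hv)
  obtain ⟨w, hw⟩ := exists_uniform_pos hfd ⟨u, hKu⟩ (fun p hp => hunit p hp.1)
    fun p hp q hq => hp.2 q hq.1
  set A : Set (LinRay X) := {v | ∀ p ∈ K, 1 ≤ ip p v} with hA
  have hAcl : IsClosed A := by
    have : A = ⋂ p ∈ K, {v | 1 ≤ ip p v} := by ext; simp [hA]
    rw [this]
    exact isClosed_biInter fun p _ => isClosed_le continuous_const (continuous_ip_right p)
  have hmid : ∀ a ∈ A, ∀ b ∈ A, ∀ m, IsMidpoint m a b → m ∈ A := by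
    intro a ha b hb m hm p hp
    have := hm.ip_le p
    linarith [ha p hp, hb p hp]
  obtain ⟨v, hv, hvmin⟩ := exists_min_speed (A := A) ⟨w, hw⟩ hAcl hmid
  have hpos : 0 < v.speed := by
    have h1 := ip_le u v
    rw [hunit u hu, one_mul] at h1
    linarith [hv u hKu]
  refine hnofix ⟨dir v hpos, fun g hg => ?_⟩
  have hgv : map g v ∈ A := by
    intro p hp
    rw [ip_map_right]
    exact hv _ (hKinv _ (inv_mem hg) p hp)
  have h0 : dist (map g v) v = 0 := dist_eq_zero_of_min_speed hmid hgv hv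
    (fun q hq => hvmin q hq) rfl
  exact Quotient.sound ⟨dist (map g v 0) (v 0), fun t ht =>
    dist_apply_le_of_dist_eq_zero h0 (mul_nonneg (abs_nonneg _) ht)⟩

end FixedPoint
end LinRay

namespace LinRay
section GoodSets
variable [MetricSpace X]

/-- The unit speed rays that stay at bounded distance from `Y`. -/
def raysNear (Y : Set X) : Set (LinRay X) :=
  {u | u.speed = 1 ∧ ∃ B, ∀ t, 0 ≤ t → infDist (u t) Y ≤ B}

/-- Nonempty closed convex sets containing every ray of `S` issuing from one of their points. -/
structure IsGood (S : Set (LinRay X)) (C : Set X) : Prop where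
  nonempty : C.Nonempty
  closed : IsClosed C
  convex : GeoConvex C
  ray_mem : ∀ u ∈ S, u 0 ∈ C → ∀ t, 0 ≤ t → u t ∈ C

variable [CAT0Space X]

theorem infDist_apply_le {C : Set X} (hC : GeoConvex C) (hne : C.Nonempty) {u : LinRay X} {B : ℝ}
    (hB : ∀ t, 0 ≤ t → infDist (u t) C ≤ B) {t : ℝ} (ht : 0 ≤ t) :
    infDist (u t) C ≤ infDist (u 0) C := by
  have hB0 : 0 ≤ B := infDist_nonneg.trans (hB 0 le_rfl)
  have := nonpos_of_forall_mul_le (c := infDist (u t) C - infDist (u 0) C) (C := t * B) fun R hR => ?_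
  · linarith
  rcases le_total t R with htR | htR
  · have h1 := u.eq_geo ht htR hR
    have h2 := infDist_geo_le hC hne (u 0) (u R) (t := t / R)
      ⟨by positivity, by rw [div_le_one hR]; exact htR⟩
    rw [← h1] at h2
    have h3 : t / R * infDist (u R) C ≤ t / R * B :=
      mul_le_mul_of_nonneg_left (hB R hR.le) (by positivity)
    have h4 : 0 ≤ t / R * infDist (u 0) C := by
      have := infDist_nonneg (x := u 0) (s := C); positivity
    have h5 : infDist (u t) C - infDist (u 0) C ≤ t / R * B := by linarith
    calc R * (infDist (u t) C - infDist (u 0) C) ≤ R * (t / R * B) := by gcongr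
      _ = t * B := by field_simp
  · have h3 : infDist (u t) C - infDist (u 0) C ≤ B := by
      linarith [hB t ht, infDist_nonneg (x := u 0) (s := C)]
    calc R * (infDist (u t) C - infDist (u 0) C) ≤ R * B := by gcongr
      _ ≤ t * B := by gcongr

theorem raysNear_congr {Y : Set X} {u v : LinRay X} (hu : u ∈ raysNear Y) (h : dist u v = 0) :
    v ∈ raysNear Y := by
  obtain ⟨h1, B, hB⟩ := hu
  refine ⟨by rw [← speed_congr h, h1], B + dist (u 0) (v 0), fun t ht => ?_⟩
  have h2 := infDist_le_infDist_add_dist (s := Y) (x := v t) (y := u t)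
  have h3 := dist_apply_le_of_dist_eq_zero h ht
  rw [dist_comm] at h2
  linarith [hB t ht]

variable [ProperSpace X]

theorem IsGood.infDist_le {Y C : Set X} (hC : IsGood (raysNear Y) C) {u : LinRay X}
    (hu : u ∈ raysNear Y) {t : ℝ} (ht : 0 ≤ t) : infDist (u t) C ≤ infDist (u 0) C := by
  obtain ⟨y, hy⟩ := hC.nonempty
  obtain ⟨v, hv0, hv, -⟩ := exists_asymptotic y u
  refine infDist_apply_le hC.convex hC.nonempty (B := dist (u 0) (v 0)) (fun s hs => ?_) ht
  exact (infDist_le_dist_of_mem (hC.ray_mem v (raysNear_congr hu hv) (hv0 ▸ hy) s hs)).trans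
    (dist_apply_le_of_dist_eq_zero hv hs)

theorem IsGood.sublevel_inter {Y C D : Set X} (hC : IsGood (raysNear Y) C)
    (hD : IsGood (raysNear Y) D) {r : ℝ} (hne : ({x | infDist x C ≤ r} ∩ D).Nonempty) :
    IsGood (raysNear Y) ({x | infDist x C ≤ r} ∩ D) where
  nonempty := hne
  closed := (isClosed_le (continuous_infDist_pt C) continuous_const).inter hD.closed
  convex := (geoConvex_infDist_le hC.convex hC.nonempty r).inter hD.convex
  ray_mem u hu h0 t ht := ⟨(hC.infDist_le hu ht).trans h0.1, hD.ray_mem u hu h0.2 t ht⟩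

omit [ProperSpace X] in
theorem isGood_self {Y : Set X} (hne : Y.Nonempty) (hcl : IsClosed Y) (hconv : GeoConvex Y) :
    IsGood (raysNear Y) Y where
  nonempty := hne
  closed := hcl
  convex := hconv
  ray_mem u hu h0 t ht := by
    obtain ⟨-, B, hB⟩ := hu
    have h1 := infDist_apply_le hconv hne hB ht
    rw [infDist_zero_of_mem h0] at h1
    exact (hcl.mem_iff_infDist_zero hne).2 (le_antisymm h1 infDist_nonneg)

theorem exists_ray_mem {Y : Set X} (hcl : IsClosed Y) (hconv : GeoConvex Y) {x₀ : X} (hx₀ : x₀ ∈ Y)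
    {x : ℕ → X} (hx : ∀ n, x n ∈ Y) (hR : Tendsto (fun n => dist x₀ (x n)) atTop atTop) :
    ∃ u ∈ raysNear Y, ∀ s, 0 ≤ s → Tendsto (fun n => geo x₀ (x n) (s / dist x₀ (x n)))
      (hyperfilter ℕ : Filter ℕ) (nhds (u s)) := by
  obtain ⟨u, hu⟩ := exists_limit x₀ x (fun n => dist x₀ (x n)) 1 hR
    (Eventually.of_forall fun n => by rw [one_mul])
  have hev (s : ℝ) (hs : 0 ≤ s) : ∀ᶠ n in (hyperfilter ℕ : Filter ℕ),
      0 < dist x₀ (x n) ∧ s / dist x₀ (x n) ∈ Icc (0:ℝ) 1 := by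
    refine Nat.hyperfilter_le_atTop ?_
    filter_upwards [hR.eventually_ge_atTop s, hR.eventually_gt_atTop 0] with n h1 h2
    exact ⟨h2, by positivity, by rw [div_le_one h2]; exact h1⟩
  refine ⟨u, ⟨?_, 0, fun t ht => ?_⟩, hu⟩
  · have h1 : Tendsto (fun n => dist x₀ (geo x₀ (x n) (1 / dist x₀ (x n))))
        (hyperfilter ℕ : Filter ℕ) (nhds (dist x₀ (u 1))) :=
      tendsto_const_nhds.dist (hu 1 zero_le_one)
    have h2 : Tendsto (fun n => dist x₀ (geo x₀ (x n) (1 / dist x₀ (x n))))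
        (hyperfilter ℕ : Filter ℕ) (nhds 1) := by
      refine tendsto_const_nhds.congr' ?_
      filter_upwards [hev 1 zero_le_one] with n hn
      rw [dist_left_geo _ _ hn.2, one_div_mul_cancel hn.1.ne']
    have h3 := tendsto_nhds_unique h1 h2
    rw [← limit_zero hu, u.dist_zero_apply zero_le_one, mul_one] at h3
    exact h3
  · refine (infDist_zero_of_mem (hcl.mem_of_tendsto (hu t ht) ?_)).le
    filter_upwards [hev t ht] with n hn
    exact hconv.geo_mem hx₀ (hx n) hn.2

theorem exists_nonneg_of_chain {Y : Set X} (hcl : IsClosed Y) (hconv : GeoConvex Y) {x₀ : X}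
    (hx₀ : x₀ ∈ Y) {C : ℕ → Set X} (hC : ∀ n, IsGood (raysNear Y) (C n)) (hCY : ∀ n, C n ⊆ Y)
    (hfar : ∀ n : ℕ, Disjoint (closedBall x₀ n) (C n)) :
    ∃ u ∈ raysNear Y, ∀ v ∈ raysNear Y, 0 ≤ ip u v := by
  choose x hxC hx using fun n => (hC n).closed.exists_infDist_eq_dist (hC n).nonempty x₀
  have hR : Tendsto (fun n => dist x₀ (x n)) atTop atTop := by
    refine tendsto_atTop_mono (fun n => ?_) tendsto_natCast_atTop_atTop
    by_contra h
    push Not at h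
    exact Set.disjoint_left.1 (hfar n) (mem_closedBall'.2 h.le) (hxC n)
  obtain ⟨u, huS, hu⟩ := exists_ray_mem hcl hconv hx₀ (fun n => hCY n (hxC n)) hR
  refine ⟨u, huS, fun v' hv'S => ?_⟩
  obtain ⟨v, hv0, hv', -⟩ := exists_asymptotic x₀ v'
  have hvS := raysNear_congr hv'S hv'
  rw [ip_congr (dist_self u) hv']
  have key : dist v u ≤ √2 := by
    refine dist_limit_le hR hu v (Eventually.of_forall fun n => ?_)
    set R := dist x₀ (x n) with hRdef
    have hR0 : 0 ≤ R := dist_nonneg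
    obtain ⟨w, hw0, hw, -⟩ := exists_asymptotic (x n) v
    have hwS := raysNear_congr hvS hw
    have h1 := dist_sq_proj_le (hC n).convex (hxC n)
      ((hC n).ray_mem w hwS (hw0 ▸ hxC n) R hR0) (hx n).ge
    have h2 := quadrilateral x₀ (v R) (w R) (x n)
    have h3 := dist_apply_le_of_dist_eq_zero hw hR0
    have h4 : dist x₀ (v R) = R := by rw [← hv0, v.dist_zero_apply hR0, hvS.1, one_mul]
    have h5 : dist (x n) (w R) = R := by rw [← hw0, w.dist_zero_apply hR0, hwS.1, one_mul]
    rw [hv0, hw0, ← hRdef] at h3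
    rw [← hRdef, h5] at h1
    rw [h4, dist_comm (w R) (x n), h5, ← hRdef] at h2
    have h6 : dist (v R) (w R) * R ≤ R * R := by gcongr
    refine le_of_sq_le_sq ?_ (by positivity)
    rw [mul_pow, Real.sq_sqrt zero_le_two]
    linarith
  have h7 : dist v u ^ 2 ≤ 2 := by
    rw [← Real.sq_sqrt zero_le_two]; gcongr
  rw [ip, dist_comm, huS.1, hvS.1]
  linarith

theorem exists_minimal_isGood {Y : Set X} (hne : Y.Nonempty) (hcl : IsClosed Y)
    (hconv : GeoConvex Y) (hneg : ∀ u ∈ raysNear Y, ∃ v ∈ raysNear Y, ip u v < 0) :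
    ∃ C ⊆ Y, Minimal (IsGood (raysNear Y)) C := by
  obtain ⟨x₀, hx₀⟩ := hne
  suffices hchain : ∀ c ⊆ {C | IsGood (raysNear Y) C ∧ C ⊆ Y}, IsChain (· ⊆ ·) c → c.Nonempty →
      ∃ D ∈ {C | IsGood (raysNear Y) C ∧ C ⊆ Y}, ∀ s ∈ c, D ⊆ s by
    obtain ⟨C, hCY, hC⟩ := zorn_superset_nonempty _ hchain Y
      ⟨isGood_self ⟨x₀, hx₀⟩ hcl hconv, Subset.rfl⟩
    exact ⟨C, hCY, hC.prop.1, fun D hD hDC => hC.le_of_le ⟨hD, hDC.trans hCY⟩ hDC⟩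
  intro c hc hchain hcne
  have hsub : ⋂₀ c ⊆ Y := by
    obtain ⟨D, hD⟩ := hcne
    exact (sInter_subset_of_mem hD).trans (hc hD).2
  refine ⟨⋂₀ c, ⟨⟨?_, isClosed_sInter fun D hD => (hc hD).1.closed, ?_, ?_⟩, hsub⟩,
    fun s hs => sInter_subset_of_mem hs⟩
  · by_contra hempty
    rw [not_nonempty_iff_eq_empty] at hempty
    have hex (n : ℕ) : ∃ D ∈ c, Disjoint (closedBall x₀ n) D := by
      have : Nonempty c := hcne.to_subtype
      obtain ⟨D, hD⟩ := (isCompact_closedBall x₀ (n:ℝ)).elim_directed_family_closed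
        (fun D : c => (D : Set X)) (fun D => (hc D.2).1.closed)
        (by rw [← sInter_eq_iInter, hempty, inter_empty])
        (by
          intro A B
          rcases hchain.total A.2 B.2 with h | h
          · exact ⟨A, Subset.rfl, h⟩
          · exact ⟨B, h, Subset.rfl⟩)
      exact ⟨D, D.2, disjoint_iff_inter_eq_empty.2 hD⟩
    choose D hDc hD using hex
    obtain ⟨u, hu, h⟩ := exists_nonneg_of_chain hcl hconv hx₀ (fun n => (hc (hDc n)).1)
      (fun n => (hc (hDc n)).2) hD
    obtain ⟨v, hv, hlt⟩ := hneg u hu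
    exact absurd (h v hv) (not_le.2 hlt)
  · intro x hx y hy γ hγ t ht D hD
    exact (hc hD).1.convex x (hx D hD) y (hy D hD) γ hγ t ht
  · intro u hu h0 t ht D hD
    exact (hc hD).1.ray_mem u hu (h0 D hD) t ht

end GoodSets
end LinRay

namespace LinRay
section MinimalSets
variable [MetricSpace X] [CAT0Space X] [ProperSpace X] {Y C D E : Set X}

open Classical in
/-- A nearest point of `C`, when there is one. -/
noncomputable def proj (C : Set X) (x : X) : X :=
  if h : ∃ p ∈ C, dist x p = infDist x C then h.choose else x

omit [CAT0Space X] in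
theorem IsGood.proj_spec {S : Set (LinRay X)} (hC : IsGood S C) (x : X) :
    proj C x ∈ C ∧ dist x (proj C x) = infDist x C := by
  have h : ∃ p ∈ C, dist x p = infDist x C := by
    obtain ⟨p, hp, h⟩ := hC.closed.exists_infDist_eq_dist hC.nonempty x
    exact ⟨p, hp, h.symm⟩
  rw [proj, dif_pos h]
  exact h.choose_spec

theorem IsGood.proj_eq {S : Set (LinRay X)} (hC : IsGood S C) {x p : X} (hp : p ∈ C)
    (h : dist x p ≤ infDist x C) : proj C x = p :=
  eq_of_dist_le_infDist hC.convex (hC.proj_spec x).1 hp (hC.proj_spec x).2.le h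

/-- The minimal sets among those containing the rays near `Y` issuing from their points. -/
abbrev IsMinGood (Y C : Set X) : Prop := Minimal (IsGood (raysNear Y)) C

theorem IsMinGood.infDist_le (hC : IsMinGood Y C) (hD : IsGood (raysNear Y) D) {x y : X}
    (hx : x ∈ C) (hy : y ∈ C) : infDist x D ≤ infDist y D :=
  (hC.le_of_le (hD.sublevel_inter hC.prop (r := infDist y D) ⟨y, le_refl (infDist y D), hy⟩)
    inter_subset_right hx).1

theorem IsMinGood.infDist_comm (hC : IsMinGood Y C) (hD : IsMinGood Y D) {x y : X}
    (hx : x ∈ C) (hy : y ∈ D) : infDist x D = infDist y C := by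
  have key {C D : Set X} (hC : IsMinGood Y C) (hD : IsMinGood Y D) {x y : X}
      (hx : x ∈ C) (hy : y ∈ D) : infDist x D ≤ infDist y C := by
    obtain ⟨h1, h2⟩ := hC.prop.proj_spec y
    rw [← h2, dist_comm]
    exact (hC.infDist_le hD.prop hx h1).trans (infDist_le_dist_of_mem hy)
  exact le_antisymm (key hC hD hx hy) (key hD hC hy hx)

theorem IsMinGood.proj_proj (hC : IsMinGood Y C) (hD : IsMinGood Y D) {x : X} (hx : x ∈ C) :
    proj C (proj D x) = x := by
  obtain ⟨h1, h2⟩ := hD.prop.proj_spec x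
  refine hC.prop.proj_eq hx ?_
  rw [dist_comm, h2, hC.infDist_comm hD hx h1]

theorem IsMinGood.dist_sq_eq (hC : IsMinGood Y C) (hD : IsMinGood Y D) {x w : X} (hx : x ∈ C)
    (hw : w ∈ D) : dist x w ^ 2 = infDist x D ^ 2 + dist (proj D x) w ^ 2 := by
  obtain ⟨h1, h2⟩ := hD.prop.proj_spec x
  obtain ⟨h3, h4⟩ := hC.prop.proj_spec w
  have h5 := dist_sq_proj_le hD.prop.convex h1 hw h2.le
  have h6 := dist_sq_proj_le hC.prop.convex hx h3 (x := proj D x)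
    (by rw [dist_comm, h2, hC.infDist_comm hD hx h1])
  have h7 := quadrilateral x (proj C w) w (proj D x)
  rw [dist_comm (proj C w) w, h4, h2, ← hC.infDist_comm hD hx hw, dist_comm w] at h7
  rw [dist_comm (proj D x) x, h2, dist_comm (proj D x)] at h6
  rw [h2] at h5
  nlinarith

theorem IsMinGood.dist_proj_left (hC : IsMinGood Y C) (hD : IsMinGood Y D) {x w : X} (hx : x ∈ C)
    (hw : w ∈ D) : dist x (proj C w) = dist (proj D x) w := by
  have h1 := hC.dist_sq_eq hD hx hw
  have h2 := hD.dist_sq_eq hC hw hx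
  rw [dist_comm w x, ← hC.infDist_comm hD hx hw, dist_comm _ x] at h2
  exact (sq_eq_sq₀ dist_nonneg dist_nonneg).1 (by linarith)

theorem IsMinGood.dist_proj_proj (hC : IsMinGood Y C) (hD : IsMinGood Y D) {x y : X} (hx : x ∈ C)
    (hy : y ∈ C) : dist (proj D x) (proj D y) = dist x y := by
  rw [← hC.dist_proj_left hD hx (hD.prop.proj_spec y).1, hC.proj_proj hD hy]

/-- An isometric self-map of `C` with displacement at most `B`. -/
structure IsBddIsom (C : Set X) (B : ℝ) (τ : X → X) : Prop where
  mapsTo : MapsTo τ C C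
  dist_eq : ∀ x ∈ C, ∀ y ∈ C, dist (τ x) (τ y) = dist x y
  bdd : ∀ x ∈ C, dist x (τ x) ≤ B

omit [ProperSpace X] in
theorem IsBddIsom.map_geo {B : ℝ} {τ : X → X} (hτ : IsBddIsom C B τ) (hC : GeoConvex C) {x y : X}
    (hx : x ∈ C) (hy : y ∈ C) {t : ℝ} (ht : t ∈ Icc (0:ℝ) 1) :
    τ (geo x y t) = geo (τ x) (τ y) t := by
  have hm := hC.geo_mem hx hy ht
  apply eq_geo_of_dist ht
  · rw [hτ.dist_eq x hx _ hm, hτ.dist_eq x hx y hy, dist_left_geo x y ht]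
  · rw [hτ.dist_eq y hy _ hm, hτ.dist_eq x hx y hy, dist_right_geo x y ht]

omit [ProperSpace X] in
theorem IsBddIsom.displacement_le {B : ℝ} {τ : X → X} (hτ : IsBddIsom C B τ)
    (hC : IsMinGood Y C) {x y : X} (hx : x ∈ C) (hy : y ∈ C) : dist x (τ x) ≤ dist y (τ y) := by
  have hcont : ContinuousOn τ C :=
    (LipschitzOnWith.of_dist_le_mul (K := 1) fun a ha b hb => by
      rw [hτ.dist_eq a ha b hb, NNReal.coe_one, one_mul]).continuousOn
  have hgood : IsGood (raysNear Y) (C ∩ (fun x => dist x (τ x)) ⁻¹' Iic (dist y (τ y))) := by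
    refine ⟨⟨y, hy, le_refl (dist y (τ y))⟩, ?_, ?_, fun u hu h0 t ht => ?_⟩
    · have h := continuous_dist.comp_continuousOn (continuousOn_id.prodMk hcont)
      exact h.preimage_isClosed_of_isClosed hC.prop.closed isClosed_Iic
    · refine geoConvex_of_geo_mem fun a ha b hb t ht => ⟨hC.prop.convex.geo_mem ha.1 hb.1 ht, ?_⟩
      have h1 : dist a (τ a) ≤ dist y (τ y) := ha.2
      have h2 : dist b (τ b) ≤ dist y (τ y) := hb.2
      rw [mem_preimage, mem_Iic, hτ.map_geo hC.prop.convex ha.1 hb.1 ht]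
      refine (dist_geo_geo _ _ _ _ ht).trans ?_
      nlinarith [ht.1, ht.2]
    · have hmem := hC.prop.ray_mem u hu h0.1
      refine ⟨hmem t ht, ?_⟩
      set w : LinRay X := ⟨fun t => τ (u t), u.speed, u.speed_nonneg, fun a ha b hb => by
        rw [hτ.dist_eq _ (hmem a ha) _ (hmem b hb), u.dist_eq a ha b hb]⟩
      have hw : dist u w = 0 := dist_eq_zero_of_bounded fun s hs => hτ.bdd _ (hmem s hs)
      exact (dist_apply_le_of_dist_eq_zero hw ht).trans h0.2
  exact (hC.le_of_le hgood inter_subset_left hx).2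

omit [ProperSpace X] in
theorem IsBddIsom.two_mul_le {B : ℝ} {τ : X → X} (hτ : IsBddIsom C B τ) (hC : IsMinGood Y C)
    {x : X} (hx : x ∈ C) : 2 * dist x (τ x) ≤ dist x (τ (τ x)) := by
  have half : (1/2:ℝ) ∈ Icc (0:ℝ) 1 := by constructor <;> norm_num
  have h1 := hτ.displacement_le hC hx (hC.prop.convex.geo_mem hx (hτ.mapsTo hx) half)
  rw [hτ.map_geo hC.prop.convex hx (hτ.mapsTo hx) half, geo_symm x _ half] at h1
  have h2 := dist_geo_geo_left (τ x) x (τ (τ x)) half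
  norm_num at h1
  linarith

omit [CAT0Space X] [ProperSpace X] in
theorem IsBddIsom.comp_self {B : ℝ} {τ : X → X} (hτ : IsBddIsom C B τ) :
    IsBddIsom C (2 * B) (τ^[2]) where
  mapsTo _ hx := hτ.mapsTo (hτ.mapsTo hx)
  dist_eq x hx y hy := by
    rw [Function.iterate_succ_apply, Function.iterate_succ_apply, Function.iterate_succ_apply,
      Function.iterate_succ_apply]
    exact (hτ.dist_eq _ (hτ.mapsTo hx) _ (hτ.mapsTo hy)).trans (hτ.dist_eq x hx y hy)
  bdd x hx := by
    have h := dist_triangle x (τ x) (τ (τ x))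
    have h1 := hτ.bdd x hx
    have h2 := hτ.bdd _ (hτ.mapsTo hx)
    exact h.trans (by linarith)

omit [ProperSpace X] in
theorem IsBddIsom.pow_mul_le {B : ℝ} {τ : X → X} (hτ : IsBddIsom C B τ) (hC : IsMinGood Y C)
    {x : X} (hx : x ∈ C) (k : ℕ) : 2 ^ k * dist x (τ x) ≤ dist x (τ^[2 ^ k] x) := by
  induction k generalizing B τ with
  | zero => simp
  | succ k ih =>
    have h1 := ih hτ.comp_self
    rw [← Function.iterate_mul, ← pow_succ'] at h1
    refine le_trans ?_ h1
    rw [pow_succ, mul_assoc]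
    gcongr
    exact hτ.two_mul_le hC hx

omit [ProperSpace X] in
theorem IsBddIsom.dist_iterate_le {B : ℝ} {τ : X → X} (hτ : IsBddIsom C B τ) (hC : IsMinGood Y C)
    {x : X} (hx : x ∈ C) (i j : ℕ) : dist (τ^[i] x) (τ^[i + j] x) ≤ j * dist x (τ x) := by
  induction j with
  | zero => simp
  | succ j ih =>
    have h1 := hτ.displacement_le hC (hτ.mapsTo.iterate (i + j) hx) hx
    rw [← Function.iterate_succ_apply' τ] at h1
    have h2 := dist_triangle (τ^[i] x) (τ^[i + j] x) (τ^[i + j + 1] x)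
    push_cast
    rw [← add_assoc]
    linarith

theorem IsMinGood.isBddIsom_proj (hC : IsMinGood Y C) (hD : IsMinGood Y D) (hE : IsMinGood Y E)
    {x₀ y₀ : X} (hx₀ : x₀ ∈ C) (hy₀ : y₀ ∈ D) :
    IsBddIsom C (infDist x₀ D + infDist y₀ E + infDist x₀ E)
      (fun x => proj C (proj E (proj D x))) where
  mapsTo x _ := (hC.prop.proj_spec _).1
  dist_eq x hx y hy := by
    rw [hE.dist_proj_proj hC (hE.prop.proj_spec _).1 (hE.prop.proj_spec _).1,
      hD.dist_proj_proj hE (hD.prop.proj_spec _).1 (hD.prop.proj_spec _).1,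
      hC.dist_proj_proj hD hx hy]
  bdd x hx := by
    obtain ⟨h1, h2⟩ := hD.prop.proj_spec x
    obtain ⟨h3, h4⟩ := hE.prop.proj_spec (proj D x)
    obtain ⟨h5, h6⟩ := hC.prop.proj_spec (proj E (proj D x))
    have h7 := dist_triangle4 x (proj D x) (proj E (proj D x)) (proj C (proj E (proj D x)))
    rw [h2, h4, h6] at h7
    have h8 := hC.infDist_le hD.prop hx hx₀
    have h9 := hD.infDist_le hE.prop h1 hy₀
    have h10 := hC.infDist_comm hE hx₀ h3
    linarith

theorem IsMinGood.proj_proj_proj (hC : IsMinGood Y C) (hD : IsMinGood Y D) (hE : IsMinGood Y E)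
    {x : X} (hx : x ∈ C) : proj C (proj E (proj D x)) = x := by
  set τ : X → X := fun x => proj C (proj E (proj D x)) with hτdef
  have hyD := (hD.prop.proj_spec x).1
  have hτ : IsBddIsom C _ τ := hC.isBddIsom_proj hD hE hx hyD
  by_contra hne
  set δ := dist x (τ x) with hδ
  have hδ0 : 0 < δ := dist_pos.2 fun h => hne h.symm
  set a := infDist x D with ha
  set b := infDist (proj D x) E with hb
  obtain ⟨k, hk⟩ := pow_unbounded_of_one_lt (2 * (a ^ 2 + b ^ 2) / δ ^ 2 + 1) one_lt_two
  set p : ℕ := 2 ^ k with hp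
  have hp1 : 1 ≤ p := Nat.one_le_two_pow
  have hpk : 2 * (a ^ 2 + b ^ 2) ≤ ((p:ℝ) - 1) * δ ^ 2 := by
    rw [← div_le_iff₀ (by positivity), hp]
    push_cast
    linarith
  obtain ⟨q, hq⟩ : ∃ q, p = q + 1 := ⟨p - 1, by omega⟩
  have hmem (i : ℕ) : τ^[i] x ∈ C := hτ.mapsTo.iterate i hx
  have hz := fun i => (hD.prop.proj_spec (τ^[i] x)).1
  have hzz := fun i => (hE.prop.proj_spec (proj D (τ^[i] x))).1
  set z := proj E (proj D (τ^[p + q] x)) with hzdef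
  have h1 : 2 * p * δ ≤ dist x z := by
    have e : τ^[2 ^ (k + 1)] x = proj C z := by
      rw [show 2 ^ (k + 1) = (p + q) + 1 by rw [pow_succ, ← hp]; omega,
        Function.iterate_succ_apply']
    have h6 := hτ.pow_mul_le hC hx (k + 1)
    rw [e, hC.dist_proj_left hE hx (hzz _)] at h6
    have h7 := hC.dist_sq_eq hE hx (hzz (p + q))
    refine le_trans (le_of_eq ?_) (h6.trans (le_of_sq_le_sq ?_ dist_nonneg))
    · rw [hp]; push_cast; ring
    · rw [h7]; nlinarith [sq_nonneg (infDist x E)]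
  have h2 : dist x (proj D (τ^[p] x)) ≤ p * δ + δ / 4 := by
    refine le_of_sq_le_sq ?_ (by positivity)
    rw [hC.dist_sq_eq hD hx (hz p), hC.dist_proj_proj hD hx (hmem p)]
    have h3 : dist x (τ^[p] x) ^ 2 ≤ (p * δ) ^ 2 := by
      have := hτ.dist_iterate_le hC hx 0 p
      rw [zero_add, Function.iterate_zero, id] at this
      gcongr
    nlinarith [sq_nonneg b, sq_nonneg δ]
  have h3 : dist (proj D (τ^[p] x)) z ≤ q * δ + δ / 4 := by
    refine le_of_sq_le_sq ?_ (by positivity)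
    rw [hD.dist_sq_eq hE (hz p) (hzz _), hD.dist_proj_proj hE (hz _) (hz _),
      hC.dist_proj_proj hD (hmem _) (hmem _)]
    have h3 : dist (τ^[p] x) (τ^[p + q] x) ^ 2 ≤ (q * δ) ^ 2 := by
      have := hτ.dist_iterate_le hC hx p q
      gcongr
    have h4 : infDist (proj D (τ^[p] x)) E ^ 2 ≤ b ^ 2 := by
      have := hD.infDist_le hE.prop (hz p) hyD
      have h0 := infDist_nonneg (x := proj D (τ^[p] x)) (s := E)
      gcongr
    have h5 : (p:ℝ) = q + 1 := by rw [hq]; push_cast; ring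
    rw [h5] at hpk
    nlinarith [sq_nonneg a, sq_nonneg δ]
  have h4 := dist_triangle x (proj D (τ^[p] x)) z
  have h5 : (p:ℝ) = q + 1 := by rw [hq]; push_cast; ring
  rw [h5] at h1 h2
  linarith

end MinimalSets
end LinRay

namespace LinRay
section Union
variable [MetricSpace X] [CAT0Space X] [ProperSpace X] {Y C D E : Set X}

omit [CAT0Space X] [ProperSpace X] in
theorem IsMinGood.eq_of_mem (hC : IsMinGood Y C) (hD : IsMinGood Y D) {x : X} (hx : x ∈ C)
    (hx' : x ∈ D) : C = D := by
  have h : IsGood (raysNear Y) (C ∩ D) :=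
    ⟨⟨x, hx, hx'⟩, hC.prop.closed.inter hD.prop.closed, hC.prop.convex.inter hD.prop.convex,
      fun u hu h0 t ht => ⟨hC.prop.ray_mem u hu h0.1 t ht, hD.prop.ray_mem u hu h0.2 t ht⟩⟩
  exact (hC.eq_of_subset h inter_subset_left).symm.trans (hD.eq_of_subset h inter_subset_right)

omit [CAT0Space X] [ProperSpace X] in
theorem isGood_univ [Nonempty X] {S : Set (LinRay X)} : IsGood S univ :=
  ⟨univ_nonempty, isClosed_univ, fun _ _ _ _ _ _ _ _ => trivial, fun _ _ _ _ _ => trivial⟩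

/-- The union of the minimal sets. -/
def minUnion (Y : Set X) : Set X := {x | ∃ C, IsMinGood Y C ∧ x ∈ C}

theorem IsMinGood.geo_mem_minUnion (hC : IsMinGood Y C) (hD : IsMinGood Y D) {x y : X}
    (hx : x ∈ C) (hy : y ∈ D) {t : ℝ} (ht : t ∈ Icc (0:ℝ) 1) : geo x y t ∈ minUnion Y := by
  set a := infDist x D with ha
  set z := geo x y t with hz
  have : Nonempty X := ⟨x⟩
  have ha' : infDist y C = a := (hC.infDist_comm hD hx hy).symm
  have hxD : ∀ p ∈ C, infDist p D = a := fun p hp =>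
    le_antisymm (hC.infDist_le hD.prop hp hx) (hC.infDist_le hD.prop hx hp)
  have hmem : z ∈ {w | infDist w C ≤ t * a} ∩ ({w | infDist w D ≤ (1 - t) * a} ∩ univ) := by
    have h1 := infDist_geo_le hC.prop.convex hC.prop.nonempty x y ht
    have h2 := infDist_geo_le hD.prop.convex hD.prop.nonempty x y ht
    rw [infDist_zero_of_mem hx, ha', mul_zero, zero_add] at h1
    rw [infDist_zero_of_mem hy, mul_zero, add_zero] at h2
    exact ⟨h1, h2, trivial⟩
  refine ⟨_, ⟨hC.prop.sublevel_inter (hD.prop.sublevel_inter isGood_univ ⟨z, hmem.2⟩) ⟨z, hmem⟩,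
    fun F hF hFS w hw => ?_⟩, hmem⟩
  have key {p w : X} (hp : p ∈ C) (hpw : dist p w ≤ t * a) (hw : infDist w D ≤ (1 - t) * a) :
      w = geo p (proj D p) t := by
    obtain ⟨h1, h2⟩ := hD.prop.proj_spec p
    obtain ⟨h3, h4⟩ := hD.prop.proj_spec w
    rw [← h4] at hw
    have h5 := dist_triangle p w (proj D w)
    have h6 : proj D p = proj D w := hD.prop.proj_eq h3 (by rw [hxD p hp]; linarith)
    rw [hxD p hp] at h2
    apply eq_geo_of_dist ht
    · rwa [h2]
    · rwa [h2, h6, dist_comm]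
  obtain ⟨hp, hpw⟩ := hC.prop.proj_spec w
  obtain ⟨q, hq⟩ := hF.nonempty
  obtain ⟨hq1, hq2⟩ := hC.prop.proj_spec q
  obtain ⟨hr, hpr⟩ := hF.proj_spec (proj C w)
  have h1 : dist (proj C w) (proj F (proj C w)) ≤ t * a := by
    rw [hpr]
    refine (hC.infDist_le hF hp hq1).trans ((infDist_le_dist_of_mem hq).trans ?_)
    rw [dist_comm, hq2]
    exact (hFS hq).1
  have h2 := key hp h1 (hFS hr).2.1
  have h3 : w = _ := key hp (by rw [dist_comm, hpw]; exact hw.1) hw.2.1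
  rw [h3, ← h2]
  exact hr

theorem geoConvex_minUnion : GeoConvex (minUnion Y) :=
  geoConvex_of_geo_mem fun _ ⟨_, hC, hx⟩ _ ⟨_, hD, hy⟩ _ ht => hC.geo_mem_minUnion hD hx hy ht

theorem isClosed_minUnion : IsClosed (minUnion Y) := by
  refine isClosed_of_closure_subset fun z hz => ?_
  set S : Set X := {w | ∀ D, IsMinGood Y D → infDist w D ≤ infDist z D} with hS
  have hgood : IsGood (raysNear Y) S := by
    have e : S = ⋂ D ∈ {D | IsMinGood Y D}, {w | infDist w D ≤ infDist z D} := by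
      ext; simp [hS]
    refine ⟨⟨z, fun D _ => le_rfl⟩, ?_, ?_, fun u hu h0 t ht D hD => ?_⟩
    · rw [e]
      exact isClosed_biInter fun D _ => isClosed_le (continuous_infDist_pt D) continuous_const
    · intro x hx y hy γ hγ t ht D hD
      exact geoConvex_infDist_le hD.prop.convex hD.prop.nonempty _ x (hx D hD) y (hy D hD) γ hγ t ht
    · exact (hD.prop.infDist_le hu ht).trans (h0 D hD)
  refine ⟨S, ⟨hgood, fun F hF hFS w hw => ?_⟩, fun D _ => le_rfl⟩
  rw [hF.closed.mem_iff_infDist_zero hF.nonempty]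
  refine le_antisymm (le_of_forall_pos_le_add fun ε hε => ?_) infDist_nonneg
  obtain ⟨y, ⟨D, hD, hy⟩, hzy⟩ := Metric.mem_closure_iff.1 hz (ε / 3) (by positivity)
  have hzD : infDist z D ≤ ε / 3 := (infDist_le_dist_of_mem hy).trans hzy.le
  obtain ⟨q, hq⟩ := hF.nonempty
  obtain ⟨hq1, hq2⟩ := hD.prop.proj_spec q
  obtain ⟨hw1, hw2⟩ := hD.prop.proj_spec w
  have h1 := hFS hq D hD
  have h2 := hw D hD
  have h3 := hD.infDist_le hF hw1 hq1
  have h4 := infDist_le_dist_of_mem (x := proj D q) hq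
  have h5 := infDist_le_infDist_add_dist (s := F) (x := w) (y := proj D w)
  rw [dist_comm] at h4
  linarith

omit [CAT0Space X] [ProperSpace X] in
theorem IsGood.image {g : X ≃ᵢ X} (hg : ∀ u ∈ raysNear Y, map g⁻¹ u ∈ raysNear Y)
    (hC : IsGood (raysNear Y) C) : IsGood (raysNear Y) (g '' C) where
  nonempty := hC.nonempty.image g
  closed := g.toHomeomorph.isClosedMap C hC.closed
  convex := by
    rintro _ ⟨x, hx, rfl⟩ _ ⟨y, hy, rfl⟩ γ hγ t ht
    refine ⟨g.symm (γ t), hC.convex x hx y hy (fun t => g.symm (γ t)) ⟨?_, ?_, ?_⟩ t ht, by simp⟩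
    · simp [hγ.1]
    · simp [hγ.2.1]
    · intro s hs t ht
      rw [g.symm.isometry.dist_eq, hγ.2.2 s hs t ht, g.isometry.dist_eq]
  ray_mem := by
    rintro u hu ⟨x, hx, hx0⟩ t ht
    refine ⟨g.symm (u t), hC.ray_mem _ (hg u hu) ?_ t ht, by simp⟩
    change g.symm (u 0) ∈ C
    rw [← hx0]
    simpa using hx

omit [CAT0Space X] [ProperSpace X] in
theorem IsMinGood.image {g : X ≃ᵢ X} (hg : ∀ u ∈ raysNear Y, map g u ∈ raysNear Y)
    (hg' : ∀ u ∈ raysNear Y, map g⁻¹ u ∈ raysNear Y) (hC : IsMinGood Y C) :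
    IsMinGood Y (g '' C) := by
  refine ⟨hC.prop.image hg', fun D hD hDC => ?_⟩
  have h1 : IsGood (raysNear Y) ((g⁻¹ : X ≃ᵢ X) '' D) := hD.image (by rwa [inv_inv])
  have h2 : (g⁻¹ : X ≃ᵢ X) '' D ⊆ C := by
    rintro _ ⟨x, hx, rfl⟩
    obtain ⟨y, hy, rfl⟩ := hDC hx
    exact (g.symm_apply_apply y).symm ▸ hy
  rintro _ ⟨x, hx, rfl⟩
  obtain ⟨y, hy, h⟩ := hC.le_of_le h1 h2 hx
  rw [← h]
  exact (g.apply_symm_apply y).symm ▸ hy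

omit [CAT0Space X] [ProperSpace X] in
theorem map_mem_raysNear {g : X ≃ᵢ X} (hg : hausdorffEDist (g '' Y) Y ≠ ⊤) {u : LinRay X}
    (hu : u ∈ raysNear Y) : map g u ∈ raysNear Y := by
  obtain ⟨h1, B, hB⟩ := hu
  refine ⟨h1, B + hausdorffDist (g '' Y) Y, fun t ht => ?_⟩
  have h2 : infDist (g (u t)) (g '' Y) = infDist (u t) Y := infDist_image g.isometry
  have h3 := infDist_le_infDist_add_hausdorffDist (x := g (u t)) hg
  rw [h2] at h3
  exact h3.trans (by linarith [hB t ht])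

theorem minUnion_eq_univ {Γ : Subgroup (X ≃ᵢ X)} (hmin : MinimalSubgroupAction Γ)
    (hY : ∀ g ∈ Γ, hausdorffEDist (g '' Y) Y ≠ ⊤) (hC : IsMinGood Y C) : minUnion Y = univ := by
  refine hmin _ ?_ isClosed_minUnion geoConvex_minUnion ?_
  · obtain ⟨x, hx⟩ := hC.prop.nonempty
    exact ⟨x, C, hC, hx⟩
  · rintro g hg x ⟨D, hD, hx⟩
    exact ⟨g '' D, hD.image (fun u => map_mem_raysNear (hY g hg))
      (fun u => map_mem_raysNear (hY _ (inv_mem hg))), mem_image_of_mem g hx⟩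

end Union
end LinRay

namespace LinRay
section Splitting
variable [MetricSpace X] [CAT0Space X] [ProperSpace X] {Y C D E : Set X}

theorem IsMinGood.proj_comp (hC : IsMinGood Y C) (hD : IsMinGood Y D) (hE : IsMinGood Y E)
    {x : X} (hx : x ∈ D) : proj E (proj C x) = proj E x := by
  have h := hE.proj_proj_proj hC hD (x := proj E (proj C x)) (hE.prop.proj_spec _).1
  rw [hC.proj_proj hE (hC.prop.proj_spec x).1, hD.proj_proj hC hx] at h
  exact h.symm

theorem IsMinGood.dist_sq_eq_add (hC : IsMinGood Y C) (hD : IsMinGood Y D) (hE : IsMinGood Y E)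
    {p x y : X} (hp : p ∈ C) (hx : x ∈ D) (hy : y ∈ E) :
    dist x y ^ 2 = dist (proj C x) (proj C y) ^ 2 + dist (proj D p) (proj E p) ^ 2 := by
  have hq := (hD.prop.proj_spec p).1
  have h1 : dist (proj D p) (proj E p) = infDist x E := by
    rw [← hD.proj_comp hC hE hp, (hE.prop.proj_spec _).2]
    exact le_antisymm (hD.infDist_le hE.prop hq hx) (hD.infDist_le hE.prop hx hq)
  rw [hD.dist_sq_eq hE hx hy, h1, ← hE.dist_proj_proj hC (hE.prop.proj_spec x).1 hy,
    hE.proj_comp hD hC hx, add_comm]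

/-- The splitting of a space that is the union of minimal sets: one factor is a minimal set, the
other the fibre over a point of the projection to it. -/
theorem nonempty_isometryEquiv_prod (hY : minUnion Y = univ) (hC : IsMinGood Y C) {p : X}
    (hp : p ∈ C) : Nonempty (X ≃ᵢ WithLp 2 (C × {f : X // proj C f = p})) := by
  have hex (x : X) : ∃ D, IsMinGood Y D ∧ x ∈ D := hY.ge (mem_univ x)
  choose L hL hmem using hex
  have hLproj (x y : X) : L (proj (L x) y) = L x :=
    (hL _).eq_of_mem (hL x) (hmem _) ((hL x).prop.proj_spec y).1
  refine ⟨⟨⟨fun x => WithLp.toLp 2 (⟨proj C x, (hC.prop.proj_spec x).1⟩,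
    ⟨proj (L x) p, hC.proj_proj (hL x) hp⟩), fun q => proj (L q.snd) q.fst, fun x => ?_,
    fun q => ?_⟩, Isometry.of_dist_eq fun x y => ?_⟩⟩
  · change proj (L (proj (L x) p)) (proj C x) = x
    rw [hLproj, (hL x).proj_proj hC (hmem x)]
  · obtain ⟨⟨⟨a, ha⟩, ⟨f, hf⟩⟩⟩ := q
    have h1 : proj C (proj (L f) a) = a := hC.proj_proj (hL f) ha
    have h2 : proj (L f) p = f := by rw [← hf, (hL f).proj_proj hC (hmem f)]
    have h3 : proj (L (proj (L f) a)) p = f := by rw [hLproj, h2]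
    exact congrArg (WithLp.toLp 2) (Prod.ext (Subtype.ext h1) (Subtype.ext h3))
  · refine (WithLp.prod_dist_eq_add (by norm_num) _ _).trans ?_
    change (dist (proj C x) (proj C y) ^ (2:ℝ) + dist (proj (L x) p) (proj (L y) p) ^ (2:ℝ)) ^
      (1 / (2:ℝ)) = dist x y
    rw [Real.rpow_two, Real.rpow_two, ← Real.sqrt_eq_rpow]
    rw [← hC.dist_sq_eq_add (hL x) (hL y) hp (hmem x) (hmem y), Real.sqrt_sq dist_nonneg]

theorem IsMinGood.eq_univ (hirr : IrreducibleCAT0 X) (hY : minUnion Y = univ)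
    (hC : IsMinGood Y C) (hnt : C.Nontrivial) : C = univ := by
  obtain ⟨p, hp⟩ := hC.prop.nonempty
  obtain ⟨e⟩ := nonempty_isometryEquiv_prod hY hC hp
  have hsub : Subsingleton {f : X // proj C f = p} := by
    rw [← not_nontrivial_iff_subsingleton]
    exact fun h => hirr ⟨_, _, _, _, e, hnt.coe_sort, h⟩
  refine eq_univ_of_forall fun x => ?_
  obtain ⟨D, hD, hx⟩ : x ∈ minUnion Y := hY ▸ mem_univ x
  have h1 : (⟨proj D p, hC.proj_proj hD hp⟩ : {f : X // proj C f = p}) =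
      ⟨p, hC.prop.proj_eq hp (by rw [dist_self]; exact infDist_nonneg)⟩ := Subsingleton.elim _ _
  have h2 : proj D p = p := congrArg Subtype.val h1
  have h3 : p ∈ D := h2 ▸ (hD.prop.proj_spec p).1
  rwa [hC.eq_of_mem hD hp h3]

theorem raysNear_nonempty (hne : ¬ Bornology.IsBounded Y) (hcl : IsClosed Y)
    (hconv : GeoConvex Y) : (raysNear Y).Nonempty := by
  obtain ⟨x₀, hx₀⟩ : Y.Nonempty := by
    by_contra h
    rw [not_nonempty_iff_eq_empty] at h
    exact hne (h ▸ Bornology.isBounded_empty)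
  have hex (n : ℕ) : ∃ x ∈ Y, (n:ℝ) < dist x₀ x := by
    by_contra! h
    exact hne ((isBounded_iff_subset_closedBall x₀).2 ⟨n, fun x hx => mem_closedBall'.2 (h x hx)⟩)
  choose x hx hlt using hex
  obtain ⟨u, hu, -⟩ := exists_ray_mem hcl hconv hx₀ hx
    (tendsto_atTop_mono (fun n => (hlt n).le) tendsto_natCast_atTop_atTop)
  exact ⟨u, hu⟩

theorem IsGood.nontrivial (hC : IsGood (raysNear Y) C) (hne : (raysNear Y).Nonempty) :
    C.Nontrivial := by
  obtain ⟨u, hu⟩ := hne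
  obtain ⟨x, hx⟩ := hC.nonempty
  obtain ⟨v, rfl, hv, -⟩ := exists_asymptotic x u
  have hvS := raysNear_congr hu hv
  refine ⟨v 0, hx, v 1, hC.ray_mem v hvS hx 1 zero_le_one, fun h => ?_⟩
  have h1 := v.dist_zero_apply zero_le_one
  rw [← h, MetricSpace.toPseudoMetricSpace.dist_self, hvS.1] at h1
  norm_num at h1

end Splitting
end LinRay

/-- minimal actions without fixed point at infinity on irreducible
spaces are reduced. -/
theorem stmt6 (X : Type u) [MetricSpace X] [ProperSpace X] [CAT0Space X]
    (hirr : IrreducibleCAT0 X) (hfd : FiniteDimTitsBoundary X)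
    (Γ : Subgroup (X ≃ᵢ X)) (hmin : MinimalSubgroupAction Γ)
    (hnofix : ¬ ∃ ξ : Boundary X, ∀ g ∈ Γ, Boundary.map (⇑g) g.isometry ξ = ξ) :
    ¬ ∃ Y : Set X, Y ≠ Set.univ ∧ ¬ Bornology.IsBounded Y ∧ IsClosed Y ∧ GeoConvex Y ∧
      ∀ g ∈ Γ, EMetric.hausdorffEdist ((⇑g) '' Y) Y ≠ ⊤ := by
  rintro ⟨Y, hne, hunb, hcl, hconv, hY⟩
  have hrays := LinRay.raysNear_nonempty hunb hcl hconv
  have hYne : Y.Nonempty := by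
    by_contra h
    rw [not_nonempty_iff_eq_empty] at h
    exact hunb (h ▸ Bornology.isBounded_empty)
  obtain ⟨C, hCY, hC⟩ := LinRay.exists_minimal_isGood hYne hcl hconv fun u hu =>
    LinRay.exists_ip_neg hfd Γ hnofix (fun u hu => hu.1)
      (fun g hg u hu => LinRay.map_mem_raysNear (hY g hg) hu) hu
  have hZ := LinRay.minUnion_eq_univ hmin hY hC
  have hCuniv := LinRay.IsMinGood.eq_univ hirr hZ hC (hC.prop.nontrivial hrays)
  exact hne (univ_subset_iff.1 (hCuniv ▸ hCY))
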